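/- arXiv:1902.07873 — 2 statements merged into one kernel-verified Lean document; each statement's English description precedes it below -/
import Mathlib

section
/- Let G be the simple graph on six vertices v1,...,v6 whose edges are the path edges v1v2, v2v3, v3v4, v4v5, v5v6 together with the chords v3v5 and v4v6 (the graph G^6_63). Then the crossing number of the Cartesian product G □ C_3 equals 6. -/
open SimpleGraph

/-- A drawing of a simple graph in the plane: vertices are mapped to distinct
points, and each edge is mapped to a simple arc (parametrised by `[0,1]`)
joining the images of its endpoints and avoiding the images of all vertices
in its interior. -/
structure Drawing {V : Type*} (G : SimpleGraph V) where
  vertexMap : V → ℝ × ℝ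
  vertexMap_injective : Function.Injective vertexMap
  arc : G.edgeSet → ℝ → ℝ × ℝ
  arc_continuousOn : ∀ e, ContinuousOn (arc e) (Set.Icc 0 1)
  arc_injOn : ∀ e, Set.InjOn (arc e) (Set.Icc 0 1)
  arc_endpoints : ∀ e : G.edgeSet, ∃ u v : V,
    (e : Sym2 V) = s(u, v) ∧ arc e 0 = vertexMap u ∧ arc e 1 = vertexMap v
  arc_avoids_vertices : ∀ e : G.edgeSet, ∀ t ∈ Set.Ioo (0 : ℝ) 1, ∀ w : V,
    arc e t ≠ vertexMap w

/-- The crossings of a drawing: an unordered pair of distinct edges together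
with a point of the plane where the two corresponding arcs intersect away
from their endpoints. -/
def Drawing.crossings {V : Type*} {G : SimpleGraph V} (D : Drawing G) :
    Set (Sym2 G.edgeSet × (ℝ × ℝ)) :=
  { x | ∃ e f : G.edgeSet, e ≠ f ∧ x.1 = s(e, f) ∧
      (∃ s ∈ Set.Ioo (0 : ℝ) 1, D.arc e s = x.2) ∧
      (∃ t ∈ Set.Ioo (0 : ℝ) 1, D.arc f t = x.2) }

/-- The crossing number of a simple graph: the minimum number of crossings
over all drawings of the graph in the plane. -/
noncomputable def crossingNumber {V : Type*} (G : SimpleGraph V) : ℕ :=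
  sInf { n : ℕ | ∃ D : Drawing G, D.crossings.Finite ∧ D.crossings.ncard = n }

/-- The graph `G⁶₆₃`: the path `v1 v2 v3 v4 v5 v6` together with the chords `v3v5` and `v4v6`. -/
def G6_63 : SimpleGraph (Fin 6) :=
  SimpleGraph.fromEdgeSet {s(0, 1), s(1, 2), s(2, 3), s(3, 4), s(4, 5), s(2, 4), s(3, 5)}

/-! ### Continuous logarithms -/

/-- A nowhere vanishing continuous function on a simply connected, locally path-connected space
has a continuous logarithm. -/
theorem exists_continuous_log {A : Type*} [TopologicalSpace A] [SimplyConnectedSpace A]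
    [LocallyPathConnectedSpace A] {f : A → ℂ} (hf : Continuous f) (hf0 : ∀ x, f x ≠ 0) :
    ∃ L : A → ℂ, Continuous L ∧ ∀ x, Complex.exp (L x) = f x := by
  have a₀ : A := Classical.arbitrary A
  obtain ⟨F, ⟨-, hF⟩, -⟩ := Complex.isCoveringMapOn_exp.existsUnique_continuousMap_lifts
    ⟨f, hf⟩ (a₀ := a₀) (Complex.exp_log (hf0 a₀)) (fun a => by simpa using hf0 a)
  exact ⟨F, F.continuous, fun x => congrFun hF x⟩

/-- Two continuous logarithms of the same function on a preconnected space have the same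
increments. -/
theorem sub_eq_sub_of_exp_eq {A : Type*} [TopologicalSpace A] [PreconnectedSpace A] {L M : A → ℂ}
    (hL : Continuous L) (hM : Continuous M) (h : ∀ x, Complex.exp (L x) = Complex.exp (M x))
    (x y : A) : L x - L y = M x - M y := by
  have hxy : Complex.exp (L y - M y) = 1 := by
    rw [Complex.exp_sub, h, div_self (Complex.exp_ne_zero _)]
  have key : L = fun z => M z + (L y - M y) :=
    Complex.isCoveringMap_exp.eq_of_comp_eq hL (by fun_prop)
      (funext fun z => Subtype.ext (by simp [Complex.exp_add, h, hxy])) y (by simp)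
  have := congrFun key x
  linear_combination this

/-! ### The parity of the winding of an edge around a vertex -/

namespace Drawing

variable {V : Type*} {G : SimpleGraph V} (D : Drawing G)

/-- The position of a vertex as a complex number. -/
noncomputable def pos (v : V) : ℂ := Complex.equivRealProdCLM.symm (D.vertexMap v)

/-- The arc of an edge, as a curve in `ℂ` extended to the whole line by constants. -/
noncomputable def curve (e : G.edgeSet) : ℝ → ℂ :=
  Set.IccExtend zero_le_one fun t : Set.Icc (0 : ℝ) 1 => Complex.equivRealProdCLM.symm (D.arc e t)

theorem continuous_curve (e : G.edgeSet) : Continuous (D.curve e) :=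
  (Complex.equivRealProdCLM.symm.continuous.comp
    (continuousOn_iff_continuous_domRestrict.1 (D.arc_continuousOn e))).Icc_extend'

theorem pos_injective : Function.Injective D.pos :=
  Complex.equivRealProdCLM.symm.injective.comp D.vertexMap_injective

theorem curve_eq (e : G.edgeSet) (s : ℝ) :
    ∃ t ∈ Set.Icc (0 : ℝ) 1, D.curve e s = Complex.equivRealProdCLM.symm (D.arc e t) :=
  ⟨_, (Set.projIcc 0 1 zero_le_one s).2, rfl⟩

theorem curve_zero (e : G.edgeSet) :
    D.curve e 0 = Complex.equivRealProdCLM.symm (D.arc e 0) :=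
  Set.IccExtend_left _ _

theorem curve_one (e : G.edgeSet) :
    D.curve e 1 = Complex.equivRealProdCLM.symm (D.arc e 1) :=
  Set.IccExtend_right _ _

/-- If two edges without a common endpoint do not cross, then their curves are disjoint. -/
theorem curve_ne_curve {e f : G.edgeSet} {a b c d : V} (he : (e : Sym2 V) = s(a, b))
    (hf : (f : Sym2 V) = s(c, d)) (hac : a ≠ c) (had : a ≠ d) (hbc : b ≠ c) (hbd : b ≠ d)
    (hcross : ∀ p, (s(e, f), p) ∉ D.crossings) (s t : ℝ) : D.curve e s ≠ D.curve f t := by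
  have ends : ∀ (g : G.edgeSet) (x y : V), (g : Sym2 V) = s(x, y) → ∀ t ∈ Set.Icc (0 : ℝ) 1,
      t ∈ Set.Ioo (0 : ℝ) 1 ∨ D.arc g t = D.vertexMap x ∨ D.arc g t = D.vertexMap y := by
    intro g x y hg t ht
    obtain ⟨u, v, huv, h0, h1⟩ := D.arc_endpoints g
    rcases ht.1.eq_or_lt with rfl | h0t
    · rcases Sym2.eq_iff.1 (hg.symm.trans huv) with ⟨rfl, rfl⟩ | ⟨rfl, rfl⟩ <;> simp [h0]
    rcases ht.2.eq_or_lt with rfl | h1t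
    · rcases Sym2.eq_iff.1 (hg.symm.trans huv) with ⟨rfl, rfl⟩ | ⟨rfl, rfl⟩ <;> simp [h1]
    exact Or.inl ⟨h0t, h1t⟩
  have hef : e ≠ f := by
    rintro rfl
    rcases Sym2.eq_iff.1 (he.symm.trans hf) with ⟨h, -⟩ | ⟨h, -⟩
    exacts [hac h, had h]
  obtain ⟨s', hs', hs⟩ := D.curve_eq e s
  obtain ⟨t', ht', ht⟩ := D.curve_eq f t
  rw [hs, ht]
  intro h
  replace h := Complex.equivRealProdCLM.symm.injective h
  have inj := D.vertexMap_injective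
  rcases ends e a b he s' hs' with h1 | h1 | h1 <;> rcases ends f c d hf t' ht' with h2 | h2 | h2
  · exact hcross (D.arc e s') ⟨e, f, hef, rfl, ⟨s', h1, rfl⟩, ⟨t', h2, h.symm⟩⟩
  · exact D.arc_avoids_vertices e s' h1 c (h.trans h2)
  · exact D.arc_avoids_vertices e s' h1 d (h.trans h2)
  · exact D.arc_avoids_vertices f t' h2 a (h.symm.trans h1)
  · exact hac (inj (h1.symm.trans (h.trans h2)))
  · exact had (inj (h1.symm.trans (h.trans h2)))
  · exact D.arc_avoids_vertices f t' h2 b (h.symm.trans h1)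
  · exact hbc (inj (h1.symm.trans (h.trans h2)))
  · exact hbd (inj (h1.symm.trans (h.trans h2)))

/-- A logarithm of `pos u - pos v`, chosen so that exchanging `u` and `v` adds `π * I` or
subtracts it according to the order of `r u` and `r v`. -/
noncomputable def logDiff (r : V → ℕ) (u v : V) : ℂ :=
  if r u < r v then Complex.log (D.pos u - D.pos v)
  else Complex.log (D.pos v - D.pos u) + Real.pi * Complex.I

theorem exp_logDiff (r : V → ℕ) {u v : V} (h : u ≠ v) :
    Complex.exp (D.logDiff r u v) = D.pos u - D.pos v := by
  have h1 : D.pos u - D.pos v ≠ 0 := sub_ne_zero.2 (D.pos_injective.ne h)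
  have h2 : D.pos v - D.pos u ≠ 0 := sub_ne_zero.2 (D.pos_injective.ne h.symm)
  unfold logDiff
  split_ifs
  · exact Complex.exp_log h1
  · rw [Complex.exp_add, Complex.exp_log h2, Complex.exp_pi_mul_I]; ring

theorem logDiff_sub_logDiff {r : V → ℕ} (hr : Function.Injective r) {u v : V} (h : u ≠ v) :
    D.logDiff r u v - D.logDiff r v u =
      Real.pi * Complex.I * (2 * ((if r v < r u then 1 else 0 : ℤ) : ℂ) - 1) := by
  rcases lt_or_gt_of_ne (hr.ne h) with h' | h'
  · simp [logDiff, h', h'.not_gt]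
  · simp [logDiff, h', h'.not_gt]; ring

/-- For an edge and a vertex, the number of full turns by which the variation of the logarithm
along the edge, seen from the vertex, differs from the variation of `logDiff`. -/
theorem exists_winding (r : V → ℕ) (e : G.edgeSet) (v : V) : ∃ k : ℤ, ∀ a b : V,
    (e : Sym2 V) = s(a, b) → D.curve e 0 = D.pos a → D.curve e 1 = D.pos b → v ≠ a → v ≠ b →
    ∀ L : ℝ → ℂ, Continuous L → (∀ t, Complex.exp (L t) = D.curve e t - D.pos v) →
    L 1 - L 0 = D.logDiff r b v - D.logDiff r a v + k * (2 * Real.pi * Complex.I) := by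
  by_cases H : ∃ M : ℝ → ℂ, Continuous M ∧ ∀ t, Complex.exp (M t) = D.curve e t - D.pos v
  swap
  · exact ⟨0, fun a b _ _ _ _ _ L hL hL' => (H ⟨L, hL, hL'⟩).elim⟩
  obtain ⟨M, hM, hM'⟩ := H
  obtain ⟨u, w, -, h0, h1⟩ := D.arc_endpoints e
  have hu : D.curve e 0 = D.pos u := by rw [curve_zero, h0]; rfl
  have hw : D.curve e 1 = D.pos w := by rw [curve_one, h1]; rfl
  by_cases hvu : v = u
  · refine ⟨0, fun a b _ ha _ hva => ?_⟩
    exact (hva (hvu.trans (D.pos_injective (hu.symm.trans ha)))).elim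
  by_cases hvw : v = w
  · refine ⟨0, fun a b _ _ hb _ hvb => ?_⟩
    exact (hvb (hvw.trans (D.pos_injective (hw.symm.trans hb)))).elim
  have key : Complex.exp (M 1 - M 0) = Complex.exp (D.logDiff r w v - D.logDiff r u v) := by
    rw [Complex.exp_sub, Complex.exp_sub, hM', hM', hu, hw, D.exp_logDiff r (Ne.symm hvu),
      D.exp_logDiff r (Ne.symm hvw)]
  obtain ⟨k, hk⟩ := Complex.exp_eq_exp_iff_exists_int.1 key
  refine ⟨k, fun a b _ ha hb _ _ L hL hL' => ?_⟩
  rw [sub_eq_sub_of_exp_eq hL hM (fun t => (hL' t).trans (hM' t).symm) 1 0, hk,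
    D.pos_injective (hu.symm.trans ha), D.pos_injective (hw.symm.trans hb)]

/-- The chords of a convex polygon with vertices in the order given by `r` cross according to
this parity. -/
def interleave {V : Type*} (r : V → ℕ) (a b c d : V) : ℤ :=
  (if r c < r b then 1 else 0) + (if r c < r a then 1 else 0) +
    (if r d < r b then 1 else 0) + (if r d < r a then 1 else 0)

/-- For edges without a common endpoint that do not cross, the windings of the edges around each
other's endpoints determine whether their endpoints interleave. -/
theorem exists_winding_parity {r : V → ℕ} (hr : Function.Injective r) :
    ∃ κ : G.edgeSet → V → ZMod 2, ∀ (e f : G.edgeSet) (a b c d : V),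
      (e : Sym2 V) = s(a, b) → (f : Sym2 V) = s(c, d) → a ≠ c → a ≠ d → b ≠ c → b ≠ d →
      (∀ p, (s(e, f), p) ∉ D.crossings) →
      κ e c + κ e d + κ f a + κ f b = (interleave r a b c d : ZMod 2) := by
  choose k hk using D.exists_winding r
  have main : ∀ (e f : G.edgeSet) (a b c d : V),
      (e : Sym2 V) = s(a, b) → D.curve e 0 = D.pos a → D.curve e 1 = D.pos b →
      (f : Sym2 V) = s(c, d) → D.curve f 0 = D.pos c → D.curve f 1 = D.pos d →
      a ≠ c → a ≠ d → b ≠ c → b ≠ d → (∀ p, (s(e, f), p) ∉ D.crossings) →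
      (k e c + k e d + k f a + k f b : ZMod 2) = (interleave r a b c d : ZMod 2) := by
    intro e f a b c d he ha hb hf hc hd hac had hbc hbd hcross
    obtain ⟨L, hL, hL'⟩ := exists_continuous_log
      (f := fun z : ℝ × ℝ => D.curve e z.1 - D.curve f z.2)
      (((D.continuous_curve e).comp continuous_fst).sub
        ((D.continuous_curve f).comp continuous_snd))
      (fun z => sub_ne_zero.2 (D.curve_ne_curve he hf hac had hbc hbd hcross z.1 z.2))
    have hneg : ∀ z w : ℂ, Complex.exp z = w → Complex.exp (z + Real.pi * Complex.I) = -w := by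
      rintro z w rfl
      rw [Complex.exp_add, Complex.exp_pi_mul_I]; ring
    have h1 := hk e c a b he ha hb hac.symm hbc.symm (fun t => L (t, 0)) (by fun_prop)
      (fun t => by rw [hL', hc])
    have h2 := hk e d a b he ha hb had.symm hbd.symm (fun t => L (t, 1)) (by fun_prop)
      (fun t => by rw [hL', hd])
    have h3 := hk f a c d hf hc hd hac had (fun t => L (0, t) + Real.pi * Complex.I)
      (by fun_prop) (fun t => by rw [hneg _ _ (hL' _), ha]; ring)
    have h4 := hk f b c d hf hc hd hbc hbd (fun t => L (1, t) + Real.pi * Complex.I)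
      (by fun_prop) (fun t => by rw [hneg _ _ (hL' _), hb]; ring)
    have t1 := D.logDiff_sub_logDiff hr hbc
    have t2 := D.logDiff_sub_logDiff hr hac
    have t3 := D.logDiff_sub_logDiff hr hbd
    have t4 := D.logDiff_sub_logDiff hr had
    have hpi : (2 * Real.pi * Complex.I : ℂ) ≠ 0 := by
      simp [Real.pi_ne_zero]
    have total : ((k e c - k e d + k f b - k f a : ℤ) : ℂ) =
        ((-(if r c < r b then 1 else 0) + (if r c < r a then 1 else 0) +
          (if r d < r b then 1 else 0) - (if r d < r a then 1 else 0) : ℤ) : ℂ) := by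
      apply mul_right_cancel₀ hpi
      push_cast at t1 t2 t3 t4 ⊢
      linear_combination -h1 + h2 + h3 - h4 - t1 + t2 + t3 - t4
    have total' : ((k e c - k e d + k f b - k f a : ℤ) : ZMod 2) =
        ((-(if r c < r b then 1 else 0) + (if r c < r a then 1 else 0) +
          (if r d < r b then 1 else 0) - (if r d < r a then 1 else 0) : ℤ) : ZMod 2) :=
      congrArg _ (Int.cast_injective total)
    unfold interleave
    push_cast [CharTwo.sub_eq_add, CharTwo.neg_eq] at total' ⊢
    linear_combination total'
  refine ⟨fun e v => k e v, fun e f a b c d he hf hac had hbc hbd hcross => ?_⟩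
  obtain ⟨u, v, huv, hu, hv⟩ := D.arc_endpoints e
  obtain ⟨w, x, hwx, hw, hx⟩ := D.arc_endpoints f
  replace hu : D.curve e 0 = D.pos u := by rw [curve_zero, hu]; rfl
  replace hv : D.curve e 1 = D.pos v := by rw [curve_one, hv]; rfl
  replace hw : D.curve f 0 = D.pos w := by rw [curve_zero, hw]; rfl
  replace hx : D.curve f 1 = D.pos x := by rw [curve_one, hx]; rfl
  rcases Sym2.eq_iff.1 (he.symm.trans huv) with ⟨rfl, rfl⟩ | ⟨rfl, rfl⟩ <;>
    rcases Sym2.eq_iff.1 (hf.symm.trans hwx) with ⟨rfl, rfl⟩ | ⟨rfl, rfl⟩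
  · exact main e f a b c d huv hu hv hwx hw hx hac had hbc hbd hcross
  · have := main e f a b d c huv hu hv hwx hw hx had hac hbd hbc hcross
    simp only [interleave] at this ⊢
    push_cast at this ⊢
    linear_combination this
  · have := main e f b a c d huv hu hv hwx hw hx hbc hbd hac had hcross
    simp only [interleave] at this ⊢
    push_cast at this ⊢
    linear_combination this
  · have := main e f b a d c huv hu hv hwx hw hx hbd hbc had hac hcross
    simp only [interleave] at this ⊢
    push_cast at this ⊢
    linear_combination this

end Drawing

/-! ### Six crossings are necessary -/

namespace G6_63

/-- The numbering of the vertices of `G6_63 □ cycleGraph 3` layer by layer. -/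
def code (v : Fin 6 × Fin 3) : ℕ := 3 * v.1 + v.2

theorem code_injective : Function.Injective code := by
  rintro ⟨a, b⟩ ⟨c, d⟩ h
  simp only [code] at h
  ext <;> simp only <;> omega

/-- The vertex of `G6_63 □ cycleGraph 3` with a given number. -/
def vertex (n : ℕ) : Fin 6 × Fin 3 := (Fin.ofNat 6 (n / 3), Fin.ofNat 3 n)

instance : DecidableRel G6_63.Adj := fun a b =>
  decidable_of_iff (s(a, b) ∈ ([s(0, 1), s(1, 2), s(2, 3), s(3, 4), s(4, 5), s(2, 4), s(3, 5)] :
    List (Sym2 (Fin 6))) ∧ a ≠ b) (by simp [G6_63])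

instance : DecidableRel (G6_63 □ cycleGraph 3).Adj := fun x y =>
  decidable_of_iff (G6_63.Adj x.1 y.1 ∧ x.2 = y.2 ∨ (x.2 ≠ y.2) ∧ x.1 = y.1) (by
    rw [boxProd_adj, cycleGraph_three_eq_top, top_adj])

/-- The numbers of the endpoints of the edges of `G6_63 □ cycleGraph 3` lying over the last four
vertices of `G6_63`. -/

def endCodes (e : Fin 27) : ℕ × ℕ := [
  (6, 9), (7, 10), (8, 11), (6, 12), (7, 13), (8, 14), (9, 12), (10, 13), (11, 14), (9, 15),
  (10, 16), (11, 17), (12, 15), (13, 16), (14, 17), (6, 7), (7, 8), (6, 8), (9, 10), (10, 11),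
  (9, 11), (12, 13), (13, 14), (12, 14), (15, 16), (16, 17), (15, 17)].getD e (0, 0)

/-- The edges of `G6_63 □ cycleGraph 3` lying over the last four vertices of `G6_63`. -/
def edge (e : Fin 27) : (G6_63 □ cycleGraph 3).edgeSet :=
  ⟨s(vertex (endCodes e).1, vertex (endCodes e).2), by
    rw [mem_edgeSet]; revert e; decide +kernel⟩

theorem edge_injective : Function.Injective edge := by
  have h : ∀ e f, s(vertex (endCodes e).1, vertex (endCodes e).2) =
      s(vertex (endCodes f).1, vertex (endCodes f).2) → e = f := by decide +kernel
  exact fun e f hef => h e f (congrArg Subtype.val hef)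

/-- Eleven sets of pairs of edges, each of which meets every drawing in a crossing. -/
def word (i : Fin 11) : List (Fin 27 × Fin 27) := [
  [(7, 3), (7, 5), (8, 3), (8, 4), (10, 4), (10, 5), (12, 7), (12, 8), (13, 1), (13, 5), (13, 8),
   (14, 1), (14, 4), (14, 7), (15, 7), (15, 8), (16, 7), (16, 10), (16, 13), (19, 3), (19, 4),
   (19, 12), (19, 13), (19, 15), (22, 1), (22, 3), (22, 10), (22, 12), (22, 15), (24, 7),
   (24, 8), (24, 19), (24, 22), (25, 1), (25, 4), (25, 7)],
  [(2, 0), (2, 1), (5, 0), (5, 1), (6, 1), (6, 2), (10, 0), (10, 2), (12, 0), (12, 2), (15, 2),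
   (15, 5), (15, 6), (17, 6), (17, 10), (17, 12), (19, 0), (19, 5), (19, 6), (19, 17), (20, 1),
   (20, 5), (20, 10), (20, 12), (20, 15), (20, 17), (23, 0), (23, 1), (23, 15), (23, 19),
   (23, 20), (24, 0), (24, 2), (24, 17), (24, 20)],
  [(9, 1), (9, 5), (10, 6), (11, 1), (11, 5), (11, 6), (11, 9), (11, 10), (14, 9), (14, 10),
   (16, 9), (16, 11), (19, 6), (19, 9), (19, 14), (20, 1), (20, 5), (20, 10), (20, 14), (20, 16),
   (23, 10), (23, 11), (23, 19), (24, 6), (24, 11), (24, 14), (24, 20), (24, 23), (26, 1),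
   (26, 5), (26, 6), (26, 16), (26, 19), (26, 20), (26, 23)],
  [(9, 8), (10, 8), (11, 9), (11, 10), (12, 10), (12, 11), (13, 9), (13, 11), (18, 8), (18, 11),
   (18, 12), (20, 12), (20, 13), (21, 9), (21, 11), (21, 20), (23, 9), (23, 10), (23, 18),
   (25, 8), (25, 9), (25, 12), (25, 20), (25, 23), (26, 8), (26, 10), (26, 13), (26, 18),
   (26, 20), (26, 21), (26, 23)],
  [(3, 1), (4, 3), (5, 1), (5, 4), (6, 4), (6, 5), (8, 3), (8, 4), (15, 8), (15, 10), (15, 13),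
   (16, 6), (16, 10), (16, 13), (17, 1), (17, 4), (17, 10), (17, 13), (18, 4), (18, 5), (18, 16),
   (19, 3), (19, 4), (19, 15), (21, 1), (21, 5), (21, 8), (21, 16), (21, 19), (22, 1), (22, 3),
   (22, 6), (22, 15), (22, 18)],
  [(6, 4), (6, 5), (7, 3), (7, 5), (10, 3), (10, 4), (12, 1), (12, 4), (12, 7), (13, 1), (13, 3),
   (13, 6), (14, 6), (14, 7), (15, 7), (15, 10), (15, 13), (16, 6), (16, 7), (18, 4), (18, 5),
   (18, 13), (18, 14), (18, 16), (21, 1), (21, 5), (21, 10), (21, 14), (21, 16), (24, 1),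
   (24, 4), (24, 7), (25, 6), (25, 7), (25, 18), (25, 21)],
  [(2, 0), (2, 1), (3, 1), (3, 2), (4, 0), (4, 2), (8, 0), (8, 1), (16, 0), (16, 3), (16, 8),
   (17, 1), (17, 4), (17, 8), (18, 2), (18, 3), (18, 8), (18, 17), (20, 3), (20, 4), (20, 16),
   (20, 17), (22, 0), (22, 2), (22, 17), (22, 20), (23, 1), (23, 2), (23, 16), (23, 18), (23, 20)],
  [(6, 1), (6, 2), (7, 0), (7, 2), (9, 1), (9, 3), (9, 7), (10, 0), (10, 3), (10, 6), (11, 6),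
   (11, 7), (12, 0), (12, 1), (15, 6), (15, 9), (15, 12), (17, 6), (17, 7), (18, 2), (18, 3),
   (18, 11), (18, 12), (18, 17), (21, 0), (21, 2), (21, 9), (21, 11), (21, 17), (24, 0), (24, 3),
   (24, 6), (26, 6), (26, 7), (26, 18), (26, 21)],
  [(12, 2), (12, 4), (12, 11), (13, 6), (13, 11), (14, 2), (14, 4), (14, 6), (14, 12), (14, 13),
   (16, 12), (16, 14), (20, 13), (20, 14), (22, 6), (22, 11), (22, 12), (22, 20), (23, 2),
   (23, 4), (23, 11), (23, 13), (23, 16), (24, 2), (24, 4), (24, 11), (24, 14), (24, 16),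
   (24, 22), (25, 2), (25, 4), (25, 6), (25, 16), (25, 20), (25, 22), (25, 23)],
  [(3, 2), (4, 0), (4, 2), (4, 3), (5, 0), (5, 4), (9, 3), (9, 5), (13, 3), (13, 5), (15, 2),
   (15, 5), (15, 9), (15, 12), (16, 0), (16, 3), (16, 9), (16, 12), (17, 12), (17, 13), (20, 3),
   (20, 4), (20, 15), (21, 0), (21, 2), (21, 17), (21, 20), (23, 0), (23, 4), (23, 9), (23, 13),
   (23, 15), (24, 3), (24, 5), (24, 17), (24, 23)],
  [(12, 8), (12, 10), (13, 8), (13, 9), (14, 9), (14, 10), (14, 12), (14, 13), (18, 13),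
   (18, 14), (19, 12), (19, 13), (21, 8), (21, 10), (21, 14), (21, 19), (22, 9), (22, 10),
   (22, 18), (25, 8), (25, 9), (25, 12), (25, 18), (25, 19), (25, 21), (25, 22), (26, 8),
   (26, 10), (26, 13), (26, 19), (26, 22)]].getD i []

/-- The incidences of the edges in a list of pairs of edges with the endpoints of their partners,
each encoded as a number. -/
def incidences (w : List (Fin 27 × Fin 27)) : List ℕ :=
  w.flatMap fun p => [18 * p.1 + (endCodes p.2).1, 18 * p.1 + (endCodes p.2).2,
    18 * p.2 + (endCodes p.1).1, 18 * p.2 + (endCodes p.1).2]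

theorem endCodes_lt : ∀ e, (endCodes e).1 < 18 ∧ (endCodes e).2 < 18 := by decide +kernel

theorem word_disjoint : ∀ i, (word i).all fun p =>
    vertex (endCodes p.1).1 ≠ vertex (endCodes p.2).1 ∧
    vertex (endCodes p.1).1 ≠ vertex (endCodes p.2).2 ∧
    vertex (endCodes p.1).2 ≠ vertex (endCodes p.2).1 ∧
    vertex (endCodes p.1).2 ≠ vertex (endCodes p.2).2 := by decide +kernel

theorem word_ordered : ∀ i, (word i).all fun p => p.2 < p.1 := by decide +kernel

/-- The set of pairs of edges in a list, encoded as the set of nonzero bits of a number. -/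
def mask (w : List (Fin 27 × Fin 27)) : ℕ :=
  w.foldr (fun p n => n ||| 2 ^ (27 * p.1 + p.2 : ℕ)) 0

theorem testBit_mask {w : List (Fin 27 × Fin 27)} {p : Fin 27 × Fin 27} (hp : p ∈ w) :
    (mask w).testBit (27 * p.1 + p.2) := by
  induction w with
  | nil => simp at hp
  | cons q w ih =>
    rw [mask, List.foldr_cons, Nat.testBit_or, Bool.or_eq_true]
    rcases List.mem_cons.1 hp with rfl | h
    · exact Or.inr Nat.testBit_two_pow_self
    · exact Or.inl (ih h)

theorem mask_word_disjoint : ∀ i j, i < j → ∀ k, j < k →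
    mask (word i) &&& mask (word j) &&& mask (word k) = 0 := by decide +kernel

theorem card_filter_mem_word_le (p : Fin 27 × Fin 27) :
    (Finset.univ.filter fun i => p ∈ word i).card ≤ 2 := by
  by_contra! h
  have key : ∀ i j k, i < j → j < k → p ∈ word i → p ∈ word j → p ∉ word k := by
    intro i j k hij hjk hi hj hk
    have := congrArg (Nat.testBit · (27 * p.1 + p.2)) (mask_word_disjoint i j hij k hjk)
    simp [testBit_mask hi, testBit_mask hj, testBit_mask hk] at this
  obtain ⟨i, j, k, hi, hj, hk, hij, hik, hjk⟩ := Finset.two_lt_card_iff.1 h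
  simp only [Finset.mem_filter, Finset.mem_univ, true_and] at hi hj hk
  rcases hij.lt_or_gt with h1 | h1 <;> rcases hik.lt_or_gt with h2 | h2 <;>
    rcases hjk.lt_or_gt with h3 | h3
  all_goals grind

theorem word_even : ∀ i, (incidences (word i)).foldr (fun i n => n ^^^ 2 ^ i) 0 = 0 := by
  decide +kernel

theorem word_odd : ∀ i, ((word i).map fun p => Drawing.interleave code
      (vertex (endCodes p.1).1) (vertex (endCodes p.1).2)
      (vertex (endCodes p.2).1) (vertex (endCodes p.2).2)).sum % 2 = 1 := by decide +kernel

theorem sum_map_eq_zero_of_foldr_xor (k : ℕ → ZMod 2) (l : List ℕ)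
    (h : l.foldr (fun i n => n ^^^ 2 ^ i) 0 = 0) : (l.map k).sum = 0 := by
  obtain ⟨N, hN⟩ : ∃ N, ∀ i ∈ l, i < N :=
    ⟨l.sum + 1, fun i hi => Nat.lt_succ_of_le (List.le_sum_of_mem hi)⟩
  suffices H : (l.map k).sum = ∑ i ∈ Finset.range N,
      if (l.foldr (fun i n => n ^^^ 2 ^ i) 0).testBit i then k i else 0 by
    rw [H, h]; simp
  clear h
  induction l with
  | nil => simp
  | cons a l ih =>
    rw [List.map_cons, List.sum_cons, ih fun i hi => hN i (List.mem_cons_of_mem _ hi),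
      ← Finset.sum_ite_eq_of_mem' (Finset.range N) a k
        (Finset.mem_range.2 (hN a List.mem_cons_self)), ← Finset.sum_add_distrib]
    refine Finset.sum_congr rfl fun i _ => ?_
    simp only [List.foldr_cons, Nat.testBit_xor, Nat.testBit_two_pow]
    by_cases hi : a = i
    · subst hi
      cases (l.foldr (fun i n => n ^^^ 2 ^ i) 0).testBit a <;> simp [CharTwo.add_self_eq_zero]
    · simp [hi, Ne.symm hi]

theorem exists_crossing_of_word (D : Drawing (G6_63 □ cycleGraph 3)) (i : Fin 11) :
    ∃ x ∈ D.crossings, ∃ p ∈ word i, x.1 = s(edge p.1, edge p.2) := by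
  by_contra! H
  obtain ⟨κ, hκ⟩ := D.exists_winding_parity code_injective
  have hdisj := fun p hp => of_decide_eq_true (List.all_eq_true.1 (word_disjoint i) p hp)
  have h0 := sum_map_eq_zero_of_foldr_xor
    (fun n => κ (edge (Fin.ofNat 27 (n / 18))) (vertex (n % 18))) _ (word_even i)
  have hdecode : ∀ e f : Fin 27,
      κ (edge (Fin.ofNat 27 ((18 * e + (endCodes f).1) / 18)))
        (vertex ((18 * e + (endCodes f).1) % 18)) = κ (edge e) (vertex (endCodes f).1) ∧
      κ (edge (Fin.ofNat 27 ((18 * e + (endCodes f).2) / 18)))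
        (vertex ((18 * e + (endCodes f).2) % 18)) = κ (edge e) (vertex (endCodes f).2) := by
    intro e f
    have := endCodes_lt f
    constructor
    · rw [show (18 * (e : ℕ) + (endCodes f).1) / 18 = e by omega,
        show (18 * (e : ℕ) + (endCodes f).1) % 18 = (endCodes f).1 by omega]
      simp
    · rw [show (18 * (e : ℕ) + (endCodes f).2) / 18 = e by omega,
        show (18 * (e : ℕ) + (endCodes f).2) % 18 = (endCodes f).2 by omega]
      simp
  have hsum : ∀ w : List (Fin 27 × Fin 27), ((incidences w).map fun n =>
      κ (edge (Fin.ofNat 27 (n / 18))) (vertex (n % 18))).sum = (w.map fun p =>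
        κ (edge p.1) (vertex (endCodes p.2).1) + κ (edge p.1) (vertex (endCodes p.2).2) +
        κ (edge p.2) (vertex (endCodes p.1).1) + κ (edge p.2) (vertex (endCodes p.1).2)).sum := by
    intro w
    induction w with
    | nil => rfl
    | cons p w ih =>
      simp only [incidences, List.flatMap_cons, List.map_append, List.sum_append,
        List.map_cons, List.sum_cons, List.map_nil, List.sum_nil, hdecode] at ih ⊢
      rw [ih]; ring
  rw [hsum, List.map_congr_left fun p hp => hκ (edge p.1) (edge p.2) _ _ _ _ rfl rfl
    (hdisj p hp).1 (hdisj p hp).2.1 (hdisj p hp).2.2.1 (hdisj p hp).2.2.2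
    fun q hq => H _ hq p hp rfl] at h0
  have h1 : (((word i).map fun p => Drawing.interleave code
      (vertex (endCodes p.1).1) (vertex (endCodes p.1).2)
      (vertex (endCodes p.2).1) (vertex (endCodes p.2).2)).sum : ZMod 2) = 0 := by
    rw [← h0, Int.cast_list_sum, List.map_map]; rfl
  have h2 := (ZMod.intCast_zmod_eq_zero_iff_dvd _ 2).1 h1
  have h3 := word_odd i
  push_cast at h2
  omega

theorem six_le_ncard_crossings (D : Drawing (G6_63 □ cycleGraph 3)) (hD : D.crossings.Finite) :
    6 ≤ D.crossings.ncard := by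
  choose x hx p hp hxp using exists_crossing_of_word D
  have hpx : ∀ i j, x i = x j → p i = p j := by
    intro i j hij
    have h : s(edge (p i).1, edge (p i).2) = s(edge (p j).1, edge (p j).2) := by
      rw [← hxp, ← hxp, hij]
    have hi := of_decide_eq_true (List.all_eq_true.1 (word_ordered i) _ (hp i))
    have hj := of_decide_eq_true (List.all_eq_true.1 (word_ordered j) _ (hp j))
    rcases Sym2.eq_iff.1 h with ⟨h1, h2⟩ | ⟨h1, h2⟩
    · exact Prod.ext (edge_injective h1) (edge_injective h2)
    · rw [edge_injective h1, edge_injective h2] at hi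
      exact absurd hi hj.not_gt
  have key := Finset.card_le_mul_card_image_of_maps_to (s := Finset.univ) (t := hD.toFinset)
    (f := x) (fun i _ => hD.mem_toFinset.2 (hx i)) 2 (by
      intro y _
      rcases (Finset.univ.filter fun i => x i = y).eq_empty_or_nonempty with h | ⟨i, hi⟩
      · simp [h]
      · refine (Finset.card_le_card fun j hj => ?_).trans (card_filter_mem_word_le (p i))
        rw [Finset.mem_filter] at hi hj ⊢
        exact ⟨Finset.mem_univ _, hpx i j (hi.2.trans hj.2.symm) ▸ hp j⟩)
  rw [Finset.card_univ, Fintype.card_fin, ← Set.ncard_eq_toFinset_card _ hD] at key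
  omega

end G6_63

/-! ### Six crossings suffice -/

theorem adj_quotOut {V : Type*} {G : SimpleGraph V} (e : G.edgeSet) :
    G.Adj (Quot.out e.1).1 (Quot.out e.1).2 := by
  have h : s((Quot.out e.1).1, (Quot.out e.1).2) = e.1 := Quot.out_eq e.1
  rw [← mem_edgeSet, h]
  exact e.2

/-- A rectilinear drawing of a graph. -/
noncomputable def Drawing.rectilinear {V : Type*} {G : SimpleGraph V} (p : V → ℝ × ℝ)
    (hp : Function.Injective p)
    (h : ∀ a b, G.Adj a b → ∀ w, p w ∉ openSegment ℝ (p a) (p b)) : Drawing G where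
  vertexMap := p
  vertexMap_injective := hp
  arc e t := AffineMap.lineMap (p (Quot.out e.1).1) (p (Quot.out e.1).2) t
  arc_continuousOn e := AffineMap.lineMap_continuous.continuousOn
  arc_injOn e := (AffineMap.lineMap_injective ℝ (hp.ne (adj_quotOut e).ne)).injOn
  arc_endpoints e := ⟨(Quot.out e.1).1, (Quot.out e.1).2, (Quot.out_eq e.1).symm, by simp, by simp⟩
  arc_avoids_vertices e t ht w hw := by
    refine h _ _ (adj_quotOut e) w ?_
    rw [openSegment_eq_image_lineMap]
    exact ⟨t, ht, hw⟩

theorem Drawing.mem_openSegment_of_rectilinear {V : Type*} {G : SimpleGraph V} {p : V → ℝ × ℝ}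
    {hp : Function.Injective p}
    {h : ∀ a b, G.Adj a b → ∀ w, p w ∉ openSegment ℝ (p a) (p b)} {e : G.edgeSet} {a b : V}
    (he : (e : Sym2 V) = s(a, b)) {t : ℝ} (ht : t ∈ Set.Ioo (0 : ℝ) 1) :
    (rectilinear p hp h).arc e t ∈ openSegment ℝ (p a) (p b) := by
  have hmem : (rectilinear p hp h).arc e t ∈
      openSegment ℝ (p (Quot.out e.1).1) (p (Quot.out e.1).2) :=
    openSegment_eq_image_lineMap ℝ (p (Quot.out e.1).1) (p (Quot.out e.1).2) ▸ ⟨t, ht, rfl⟩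
  have hout : s((Quot.out e.1).1, (Quot.out e.1).2) = s(a, b) := (Quot.out_eq e.1).trans he
  rcases Sym2.eq_iff.1 hout with ⟨h1, h2⟩ | ⟨h1, h2⟩
  · rwa [h1, h2] at hmem
  · rwa [h1, h2, openSegment_symm] at hmem

/-- Twice the signed area of the triangle with the given vertices. -/
def signedArea {R : Type*} [CommRing R] (a b c : R × R) : R :=
  (b.1 - a.1) * (c.2 - a.2) - (b.2 - a.2) * (c.1 - a.1)

theorem exists_signedArea_combination {a b c d x : ℝ × ℝ} (hx : x ∈ openSegment ℝ a b)
    (hx' : x ∈ openSegment ℝ c d) : ∃ s t : ℝ, 0 < s ∧ 0 < t ∧ s + t = 1 ∧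
      s • c + t • d = x ∧ s * signedArea a b c + t * signedArea a b d = 0 := by
  obtain ⟨u, v, -, -, huv, rfl⟩ := hx
  obtain ⟨s, t, hs, ht, hst, h⟩ := hx'
  refine ⟨s, t, hs, ht, hst, h, ?_⟩
  have h1 : s * c.1 + t * d.1 = u * a.1 + v * b.1 := congrArg Prod.fst h
  have h2 : s * c.2 + t * d.2 = u * a.2 + v * b.2 := congrArg Prod.snd h
  obtain rfl : t = 1 - s := by linarith
  obtain rfl : v = 1 - u := by linarith
  simp only [signedArea]
  linear_combination (b.1 - a.1) * h2 - (b.2 - a.2) * h1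

theorem openSegment_inter_subsingleton {a b c d x y : ℝ × ℝ}
    (h : signedArea a b c ≠ signedArea a b d)
    (hx : x ∈ openSegment ℝ a b) (hx' : x ∈ openSegment ℝ c d)
    (hy : y ∈ openSegment ℝ a b) (hy' : y ∈ openSegment ℝ c d) : x = y := by
  obtain ⟨s, t, -, -, hst, rfl, h1⟩ := exists_signedArea_combination hx hx'
  obtain ⟨u, v, -, -, huv, rfl, h2⟩ := exists_signedArea_combination hy hy'
  obtain rfl : t = 1 - s := by linarith
  obtain rfl : v = 1 - u := by linarith
  have hsu : s = u := by
    refine sub_eq_zero.1 ((mul_eq_zero.1 ?_).resolve_right (sub_ne_zero.2 h))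
    linear_combination h1 - h2
  rw [hsu]

/-- The point of the plane with given integer coordinates. -/
def ofIntPoint (a : ℤ × ℤ) : ℝ × ℝ := (a.1, a.2)

theorem ofIntPoint_injective : Function.Injective ofIntPoint := fun a b h => by
  simpa [ofIntPoint, Prod.ext_iff] using h

theorem signedArea_ofIntPoint (a b c : ℤ × ℤ) :
    signedArea (ofIntPoint a) (ofIntPoint b) (ofIntPoint c) = signedArea a b c := by
  simp [signedArea, ofIntPoint]

/-- The points `c` and `d` lie weakly on one side of the line through `a` and `b`, and do not both
lie on this line. -/
def WeaklySameSide (a b c d : ℤ × ℤ) : Prop :=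
  0 ≤ signedArea a b c ∧ 0 < signedArea a b d ∨ 0 < signedArea a b c ∧ 0 ≤ signedArea a b d ∨
  signedArea a b c ≤ 0 ∧ signedArea a b d < 0 ∨ signedArea a b c < 0 ∧ signedArea a b d ≤ 0

instance (a b c d : ℤ × ℤ) : Decidable (WeaklySameSide a b c d) :=
  inferInstanceAs (Decidable (_ ∨ _))

theorem WeaklySameSide.notMem_openSegment {a b c d : ℤ × ℤ} (h : WeaklySameSide a b c d)
    {x : ℝ × ℝ} (hx : x ∈ openSegment ℝ (ofIntPoint a) (ofIntPoint b)) :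
    x ∉ openSegment ℝ (ofIntPoint c) (ofIntPoint d) := fun hx' => by
  obtain ⟨s, t, hs, ht, -, -, hst⟩ := exists_signedArea_combination hx hx'
  simp only [signedArea_ofIntPoint] at hst
  rcases h with ⟨h1, h2⟩ | ⟨h1, h2⟩ | ⟨h1, h2⟩ | ⟨h1, h2⟩ <;> rify at h1 h2
  · nlinarith [mul_pos ht h2, mul_nonneg hs.le h1]
  · nlinarith [mul_pos hs h1, mul_nonneg ht.le h2]
  · nlinarith [mul_pos_of_neg_of_neg (neg_neg_of_pos ht) h2, mul_nonneg_of_nonpos_of_nonpos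
      (neg_neg_of_pos hs).le h1]
  · nlinarith [mul_pos_of_neg_of_neg (neg_neg_of_pos hs) h1, mul_nonneg_of_nonpos_of_nonpos
      (neg_neg_of_pos ht).le h2]

theorem signedArea_eq_zero_of_mem_openSegment {a b c : ℝ × ℝ} (h : c ∈ openSegment ℝ a b) :
    signedArea a b c = 0 := by
  obtain ⟨u, v, -, -, huv, rfl⟩ := h
  obtain rfl : v = 1 - u := by linarith
  simp only [signedArea, Prod.fst_add, Prod.snd_add, Prod.smul_fst, Prod.smul_snd, smul_eq_mul]
  ring

namespace G6_63

/-- The positions of the vertices in a rectilinear drawing with six crossings. -/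
def position (n : ℕ) : ℤ × ℤ :=
  [(22, 8), (18, 13), (17, 21), (25, 4), (8, 22), (21, 26), (2, 1), (21, 8), (1, 29), (3, 6),
    (4, 2), (4, 17), (3, 20), (17, 9), (7, 16), (6, 5), (13, 7), (11, 9)].getD n (0, 0)

/-- The endpoints of the edges of `G6_63 □ cycleGraph 3`. -/
def edgeCodes : List (ℕ × ℕ) :=
  [(0, 3), (1, 4), (2, 5), (3, 6), (4, 7), (5, 8), (6, 9), (7, 10), (8, 11), (9, 12), (10, 13),
    (11, 14), (12, 15), (13, 16), (14, 17), (6, 12), (7, 13), (8, 14), (9, 15), (10, 16), (11, 17),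
    (0, 1), (1, 2), (0, 2), (3, 4), (4, 5), (3, 5), (6, 7), (7, 8), (6, 8), (9, 10), (10, 11),
    (9, 11), (12, 13), (13, 14), (12, 14), (15, 16), (16, 17), (15, 17)]

/-- The pairs of edges that cross in the rectilinear drawing. -/
def crossingPairs : List ((ℕ × ℕ) × (ℕ × ℕ)) :=
  [((8, 11), (12, 13)), ((8, 11), (12, 14)), ((12, 15), (10, 11)), ((12, 15), (9, 11)),
    ((8, 14), (12, 13)), ((9, 15), (10, 11))]

theorem code_mem_edgeCodes : ∀ a b, (G6_63 □ cycleGraph 3).Adj a b →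
    (code a, code b) ∈ edgeCodes ∨ (code b, code a) ∈ edgeCodes := by decide +kernel

theorem position_code_injective : Function.Injective fun v => position (code v) := by
  have h : ∀ a b, position (code a) = position (code b) → a = b := by decide +kernel
  exact h

theorem signedArea_position_ne_zero : ∀ q ∈ edgeCodes, ∀ w < 18, w ≠ q.1 → w ≠ q.2 →
    signedArea (position q.1) (position q.2) (position w) ≠ 0 := by decide +kernel

theorem weaklySameSide_or_mem_crossingPairs : ∀ q ∈ edgeCodes, ∀ r ∈ edgeCodes,
    q = r ∨ WeaklySameSide (position q.1) (position q.2) (position r.1) (position r.2) ∨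
    WeaklySameSide (position r.1) (position r.2) (position q.1) (position q.2) ∨
    (q, r) ∈ crossingPairs ∨ (r, q) ∈ crossingPairs := by decide +kernel

theorem signedArea_ne_of_mem_crossingPairs : ∀ q ∈ crossingPairs,
    signedArea (position q.1.1) (position q.1.2) (position q.2.1) ≠
    signedArea (position q.1.1) (position q.1.2) (position q.2.2) := by decide +kernel

/-- The open segment joining the positions of two vertices. -/
def positionSegment (q : ℕ × ℕ) : Set (ℝ × ℝ) :=
  openSegment ℝ (ofIntPoint (position q.1)) (ofIntPoint (position q.2))

theorem exists_code_eq (e : (G6_63 □ cycleGraph 3).edgeSet) : ∃ a b,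
    (e : Sym2 (Fin 6 × Fin 3)) = s(a, b) ∧ (code a, code b) ∈ edgeCodes := by
  obtain ⟨e, he⟩ := e
  induction e using Sym2.ind with
  | _ a b =>
    rcases code_mem_edgeCodes a b he with h | h
    · exact ⟨a, b, rfl, h⟩
    · exact ⟨b, a, Sym2.eq_swap, h⟩

theorem code_lt (v : Fin 6 × Fin 3) : code v < 18 := by
  simp only [code]; omega

theorem position_notMem_openSegment (q : ℕ × ℕ) (hq : q ∈ edgeCodes) (hne : position q.1 ≠
    position q.2) (v : Fin 6 × Fin 3) : ofIntPoint (position (code v)) ∉ positionSegment q := by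
  intro h
  by_cases h1 : code v = q.1
  · rw [h1, positionSegment, left_mem_openSegment_iff] at h
    exact hne (ofIntPoint_injective h)
  by_cases h2 : code v = q.2
  · rw [h2, positionSegment, right_mem_openSegment_iff] at h
    exact hne (ofIntPoint_injective h)
  have h0 := signedArea_eq_zero_of_mem_openSegment h
  rw [signedArea_ofIntPoint, Int.cast_eq_zero] at h0
  exact signedArea_position_ne_zero q hq _ (code_lt v) h1 h2 h0

/-- A rectilinear drawing of `G6_63 □ cycleGraph 3` with six crossings. -/
noncomputable def drawing : Drawing (G6_63 □ cycleGraph 3) :=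
  Drawing.rectilinear (fun v => ofIntPoint (position (code v)))
    (ofIntPoint_injective.comp position_code_injective) fun a b hab w => by
      have hne := position_code_injective.ne hab.ne
      rcases code_mem_edgeCodes a b hab with h | h
      · exact position_notMem_openSegment _ h hne w
      · rw [openSegment_symm]
        exact position_notMem_openSegment _ h hne.symm w

theorem drawing_arc_mem_positionSegment {e : (G6_63 □ cycleGraph 3).edgeSet} {a b : Fin 6 × Fin 3}
    (he : (e : Sym2 (Fin 6 × Fin 3)) = s(a, b)) {t : ℝ} (ht : t ∈ Set.Ioo (0 : ℝ) 1) :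
    drawing.arc e t ∈ positionSegment (code a, code b) :=
  Drawing.mem_openSegment_of_rectilinear (p := fun v => ofIntPoint (position (code v))) he ht

theorem exists_mem_crossingPairs {x : Sym2 (G6_63 □ cycleGraph 3).edgeSet × (ℝ × ℝ)}
    (hx : x ∈ drawing.crossings) : ∃ q ∈ crossingPairs,
      x.1.map (fun e => e.1.map code) = s(s(q.1.1, q.1.2), s(q.2.1, q.2.2)) ∧
      x.2 ∈ positionSegment q.1 ∧ x.2 ∈ positionSegment q.2 := by
  obtain ⟨e, f, hef, hxef, ⟨s, hs, hes⟩, ⟨t, ht, hft⟩⟩ := hx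
  obtain ⟨a, b, he, hab⟩ := exists_code_eq e
  obtain ⟨c, d, hf, hcd⟩ := exists_code_eq f
  have h1 : x.2 ∈ positionSegment (code a, code b) :=
    hes ▸ drawing_arc_mem_positionSegment he hs
  have h2 : x.2 ∈ positionSegment (code c, code d) :=
    hft ▸ drawing_arc_mem_positionSegment hf ht
  rcases weaklySameSide_or_mem_crossingPairs _ hab _ hcd with h | h | h | h | h
  · refine absurd (Subtype.ext ?_) hef
    rw [he, hf, code_injective (congrArg Prod.fst h), code_injective (congrArg Prod.snd h)]
  · exact absurd h2 (h.notMem_openSegment h1)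
  · exact absurd h1 (h.notMem_openSegment h2)
  · exact ⟨_, h, by simp [hxef, he, hf], h1, h2⟩
  · exact ⟨_, h, by simp [hxef, he, hf, Sym2.eq_swap], h2, h1⟩

theorem drawing_crossings : drawing.crossings.Finite ∧ drawing.crossings.ncard ≤ 6 := by
  choose q hq hmap hfst hsnd using fun x : drawing.crossings => exists_mem_crossingPairs x.2
  let g : drawing.crossings → crossingPairs.toFinset := fun x => ⟨q x, List.mem_toFinset.2 (hq x)⟩
  have hg : Function.Injective g := by
    intro x y hxy
    have h : q x = q y := congrArg Subtype.val hxy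
    refine Subtype.ext (Prod.ext ?_ ?_)
    · refine Sym2.map.injective (fun e f hef => Subtype.ext
        (Sym2.map.injective code_injective hef)) ?_
      rw [hmap, hmap, h]
    · have hne := signedArea_ne_of_mem_crossingPairs _ (hq x)
      refine openSegment_inter_subsingleton ?_ (hfst x) (hsnd x) (h ▸ hfst y) (h ▸ hsnd y)
      simpa only [signedArea_ofIntPoint, ne_eq, Int.cast_inj] using hne
  refine ⟨Finite.of_injective g hg, (Nat.card_le_card_of_injective g hg).trans ?_⟩
  rw [Nat.card_eq_fintype_card, Fintype.card_coe]
  exact List.toFinset_card_le _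

end G6_63

/-- The crossing number of `G⁶₆₃ □ C₃` is `6`. -/
theorem crossingNumber_G6_63_boxProd_C3 :
    crossingNumber (G6_63 □ SimpleGraph.cycleGraph 3) = 6 := by
  obtain ⟨hfin, hle⟩ := G6_63.drawing_crossings
  have hmem : G6_63.drawing.crossings.ncard ∈ {n : ℕ | ∃ D : Drawing (G6_63 □ cycleGraph 3),
      D.crossings.Finite ∧ D.crossings.ncard = n} := ⟨_, hfin, rfl⟩
  refine le_antisymm ((Nat.sInf_le hmem).trans hle) (le_csInf ⟨_, hmem⟩ ?_)
  rintro _ ⟨D, hD, rfl⟩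
  exact G6_63.six_le_ncard_crossings D hD
end

section
/- Let G be the simple graph on six vertices v1,...,v6 whose edges are the path edges v1v2, v2v3, v3v4, v4v5, v5v6 together with the chords v2v4 and v3v5 (the graph G^6_75). Then the crossing number of the Cartesian product G □ C_3 equals 6. -/
open SimpleGraph

/-- The graph `G⁶₇₅`: the path `v1 v2 v3 v4 v5 v6` together with the chords `v2v4` and `v3v5`. -/
def G6_75 : SimpleGraph (Fin 6) :=
  SimpleGraph.fromEdgeSet {s(0, 1), s(1, 2), s(2, 3), s(3, 4), s(4, 5), s(1, 3), s(2, 4)}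

/-- A nowhere vanishing continuous function on a simply connected space has a continuous
logarithm. -/
theorem exists_continuous_exp_eq {X : Type*} [TopologicalSpace X] [SimplyConnectedSpace X]
    [LocallyPathConnectedSpace X] {f : X → ℂ} (hf : Continuous f) (hf₀ : ∀ x, f x ≠ 0) :
    ∃ g : X → ℂ, Continuous g ∧ ∀ x, Complex.exp (g x) = f x := by
  obtain ⟨x₀⟩ : Nonempty X := inferInstance
  obtain ⟨g, ⟨-, hg⟩, -⟩ := Complex.isCoveringMapOn_exp.existsUnique_continuousMap_lifts
    ⟨f, hf⟩ (Complex.exp_log (hf₀ x₀)) hf₀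
  exact ⟨g, g.continuous, fun x ↦ congrFun hg x⟩

/-- Two continuous functions with the same exponential have the same increments. -/
theorem sub_eq_sub_of_exp_eq_s11 {g h : ℝ → ℂ} (hg : Continuous g) (hh : Continuous h)
    (heq : ∀ t, Complex.exp (g t) = Complex.exp (h t)) (s t : ℝ) : g t - g s = h t - h s := by
  have key := Complex.isCoveringMap_exp.const_of_comp (hg.sub hh)
    (fun x y ↦ by simp [Complex.exp_sub, heq]) t s
  simp only [Pi.sub_apply] at key
  linear_combination key

open Classical in
/-- The increment over `[0, 1]` of a continuous logarithm of `f`. -/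
noncomputable def logIncrement (f : ℝ → ℂ) : ℂ :=
  if h : ∃ g : ℝ → ℂ, Continuous g ∧ ∀ t, Complex.exp (g t) = f t then
    h.choose 1 - h.choose 0
  else 0

theorem logIncrement_eq {f g : ℝ → ℂ} (hg : Continuous g) (hgf : ∀ t, Complex.exp (g t) = f t) :
    logIncrement f = g 1 - g 0 := by
  have h : ∃ g : ℝ → ℂ, Continuous g ∧ ∀ t, Complex.exp (g t) = f t := ⟨g, hg, hgf⟩
  rw [logIncrement, dif_pos h]
  exact sub_eq_sub_of_exp_eq_s11 h.choose_spec.1 hg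
    (fun t ↦ (h.choose_spec.2 t).trans (hgf t).symm) 0 1

theorem exists_logIncrement_eq {f : ℝ → ℂ} (hf : Continuous f) (hf₀ : ∀ t, f t ≠ 0) {u v : ℂ}
    (hu : Complex.exp u = f 0) (hv : Complex.exp v = f 1) :
    ∃ n : ℤ, logIncrement f = v - u + n * (2 * Real.pi * Complex.I) := by
  obtain ⟨g, hg, hgf⟩ := exists_continuous_exp_eq hf hf₀
  obtain ⟨m, hm⟩ := Complex.exp_eq_exp_iff_exists_int.1 ((hgf 0).trans hu.symm)
  obtain ⟨n, hn⟩ := Complex.exp_eq_exp_iff_exists_int.1 ((hgf 1).trans hv.symm)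
  refine ⟨n - m, ?_⟩
  rw [logIncrement_eq hg hgf, hm, hn]
  push_cast
  ring

/-- If two curves are disjoint, the total change of the argument of their difference around the
boundary of the parameter square vanishes. -/
theorem logIncrement_boundary {γ δ : ℝ → ℂ} (hγ : Continuous γ) (hδ : Continuous δ)
    (hne : ∀ s t, γ s ≠ δ t) :
    logIncrement (fun s ↦ γ s - δ 0) + logIncrement (fun t ↦ δ t - γ 1) =
      logIncrement (fun s ↦ γ s - δ 1) + logIncrement (fun t ↦ δ t - γ 0) := by
  obtain ⟨F, hF, hFe⟩ := exists_continuous_exp_eq (X := ℝ × ℝ)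
    (f := fun p ↦ γ p.1 - δ p.2) (by fun_prop) (fun p ↦ sub_ne_zero.2 (hne p.1 p.2))
  have h₁ (t : ℝ) : logIncrement (fun s ↦ γ s - δ t) = F (1, t) - F (0, t) :=
    logIncrement_eq (g := fun s ↦ F (s, t)) (by fun_prop) fun s ↦ hFe (s, t)
  have h₂ (s : ℝ) : logIncrement (fun t ↦ δ t - γ s) = F (s, 1) - F (s, 0) := by
    rw [logIncrement_eq (g := fun t ↦ F (s, t) + Real.pi * Complex.I) (by fun_prop) fun t ↦ ?_]
    · ring
    · rw [Complex.exp_add, Complex.exp_pi_mul_I, hFe]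
      ring
  rw [h₁, h₁, h₂, h₂]
  ring

/-- For pairwise distinct points `a i`, logarithms of the differences `a i - a k` can be chosen
so that exchanging `i < k` adds `π i`. -/
theorem exists_log_sub {a : Fin 3 → ℂ} (ha : Function.Injective a) :
    ∃ L : Fin 3 → Fin 3 → ℂ, (∀ i k, i ≠ k → Complex.exp (L i k) = a i - a k) ∧
      ∀ i k, i < k → L k i = L i k + Real.pi * Complex.I := by
  refine ⟨fun i k ↦ if i < k then Complex.log (a i - a k)
    else Complex.log (a k - a i) + Real.pi * Complex.I, fun i k hik ↦ ?_, fun i k hik ↦ ?_⟩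
  · have h₁ : a i - a k ≠ 0 := sub_ne_zero.2 (ha.ne hik)
    have h₂ : a k - a i ≠ 0 := sub_ne_zero.2 (ha.ne hik.symm)
    dsimp only
    split_ifs
    · exact Complex.exp_log h₁
    · rw [Complex.exp_add, Complex.exp_pi_mul_I, Complex.exp_log h₂]
      ring
  · simp [hik, hik.not_gt]

/-- `K₃,₃` is not planar: among nine curves joining each of three points to each of three other
points, two curves without a common end intersect. -/
theorem exists_curves_intersect (a b : Fin 3 → ℂ) (γ : Fin 3 → Fin 3 → ℝ → ℂ)
    (hγ : ∀ i j, Continuous (γ i j)) (hγ₀ : ∀ i j, γ i j 0 = a i) (hγ₁ : ∀ i j, γ i j 1 = b j) :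
    ∃ i k j l, i ≠ k ∧ j ≠ l ∧ ∃ s t, γ i j s = γ k l t := by
  by_contra! hne
  have other (i : Fin 3) : ∃ k, i ≠ k := ⟨i + 1, by revert i; decide⟩
  have γ_ne_a {i j k} (hik : i ≠ k) (s : ℝ) : γ i j s - a k ≠ 0 := by
    obtain ⟨l, hl⟩ := other j
    rw [← hγ₀ k l, sub_ne_zero]
    exact hne _ _ _ _ hik hl _ _
  have γ_ne_b {i j l} (hjl : j ≠ l) (s : ℝ) : γ i j s - b l ≠ 0 := by
    obtain ⟨k, hk⟩ := other i
    rw [← hγ₁ k l, sub_ne_zero]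
    exact hne _ _ _ _ hk hjl _ _
  have ha : Function.Injective a := fun i k h ↦ by
    by_contra hik
    exact γ_ne_a (j := 0) hik 0 (by rw [hγ₀, h, sub_self])
  have hb : Function.Injective b := fun j l h ↦ by
    by_contra hjl
    exact γ_ne_b (i := 0) hjl 1 (by rw [hγ₁, h, sub_self])
  have hab (i j) : a i - b j ≠ 0 := by
    obtain ⟨l, hl⟩ := other j
    rw [← hγ₀ i l]
    exact γ_ne_b hl.symm 0
  obtain ⟨A, hA, hA'⟩ := exists_log_sub ha
  obtain ⟨B, hB, hB'⟩ := exists_log_sub hb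
  have hC (i j) := Complex.exp_log (hab i j)
  set C := fun i j ↦ Complex.log (a i - b j)
  have exists_m (i j k) (hik : i ≠ k) : ∃ m : ℤ, logIncrement (fun s ↦ γ i j s - a k) =
      C k j + Real.pi * Complex.I - A i k + m * (2 * Real.pi * Complex.I) := by
    refine exists_logIncrement_eq (by fun_prop) (γ_ne_a hik) ?_ ?_
    · rw [hA i k hik, hγ₀]
    · rw [Complex.exp_add, Complex.exp_pi_mul_I, hC, hγ₁]
      ring
  have exists_n (i j l) (hjl : j ≠ l) : ∃ n : ℤ, logIncrement (fun s ↦ γ i j s - b l) =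
      B j l - C i l + n * (2 * Real.pi * Complex.I) := by
    refine exists_logIncrement_eq (by fun_prop) (γ_ne_b hjl) ?_ ?_
    · rw [hC, hγ₀]
    · rw [hB j l hjl, hγ₁]
  choose! m hm using exists_m
  choose! n hn using exists_n
  have two_pi_I_ne : 2 * ((Real.pi : ℂ) * Complex.I) ≠ 0 := by
    rw [← mul_assoc]
    exact Complex.two_pi_I_ne_zero
  have relation (i k j l) (hik : i < k) (hjl : j ≠ l) :
      (A k i - A i k) + (B l j - B j l) +
        (m i j k + n k l j - n i j l - m k l i) * (2 * Real.pi * Complex.I) = 0 := by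
    have h := logIncrement_boundary (hγ i j) (hγ k l) (hne i k j l hik.ne hjl)
    simp only [hγ₀, hγ₁] at h
    rw [hm i j k hik.ne, hn k l j hjl.symm, hn i j l hjl, hm k l i hik.ne'] at h
    linear_combination h
  have relation_lt (i k j l) (hik : i < k) (hjl : j < l) :
      m i j k + n k l j - n i j l - m k l i = -1 := by
    have h := relation i k j l hik hjl.ne
    rw [hA' i k hik, hB' j l hjl] at h
    have h' : (2 * (Real.pi * Complex.I)) * (m i j k + n k l j - n i j l - m k l i + 1) = 0 := by
      linear_combination h
    rw [mul_eq_zero_iff_left two_pi_I_ne] at h'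
    exact eq_neg_of_add_eq_zero_left (by exact_mod_cast h')
  have relation_gt (i k j l) (hik : i < k) (hjl : l < j) :
      m i j k + n k l j - n i j l - m k l i = 0 := by
    have h := relation i k j l hik hjl.ne'
    rw [hA' i k hik, hB' l j hjl] at h
    have h' : (2 * (Real.pi * Complex.I)) * (m i j k + n k l j - n i j l - m k l i) = 0 := by
      linear_combination h
    rw [mul_eq_zero_iff_left two_pi_I_ne] at h'
    exact_mod_cast h'
  have relations (i k) (hik : i < k) := And.intro
    (And.intro (relation_lt i k 0 1 hik (by decide)) (relation_gt i k 1 0 hik (by decide)))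
    (And.intro
      (And.intro (relation_lt i k 0 2 hik (by decide)) (relation_gt i k 2 0 hik (by decide)))
      (And.intro (relation_lt i k 1 2 hik (by decide)) (relation_gt i k 2 1 hik (by decide))))
  have h₀₁ := relations 0 1 (by decide)
  have h₀₂ := relations 0 2 (by decide)
  have h₁₂ := relations 1 2 (by decide)
  omega

theorem exists_inter_nonempty_of_joinedIn {a b : Fin 3 → ℝ × ℝ} {S : Fin 3 → Fin 3 → Set (ℝ × ℝ)}
    (h : ∀ i j, JoinedIn (S i j) (a i) (b j)) :
    ∃ i k j l, i ≠ k ∧ j ≠ l ∧ (S i j ∩ S k l).Nonempty := by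
  let φ := Complex.equivRealProdCLM.symm
  obtain ⟨i, k, j, l, hik, hjl, s, t, hst⟩ :=
    exists_curves_intersect (φ ∘ a) (φ ∘ b) (fun i j ↦ φ ∘ (h i j).somePath.extend)
      (fun i j ↦ by fun_prop) (by simp) (by simp)
  refine ⟨i, k, j, l, hik, hjl, (h i j).somePath.extend s, ?_, ?_⟩
  · exact (h i j).somePath_mem _
  · rw [φ.injective hst]
    exact (h k l).somePath_mem _

namespace Drawing

variable {V : Type*} {G : SimpleGraph V} (D : Drawing G)

theorem exists_mem_arc_eq_vertexMap {e : G.edgeSet} {t : ℝ} (ht : t ∈ Set.Icc (0 : ℝ) 1)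
    (ht' : t ∉ Set.Ioo (0 : ℝ) 1) : ∃ w ∈ (e : Sym2 V), D.arc e t = D.vertexMap w := by
  obtain ⟨u, v, he, h₀, h₁⟩ := D.arc_endpoints e
  rcases Set.eq_endpoints_or_mem_Ioo_of_mem_Icc ht with rfl | rfl | h
  · exact ⟨u, by simp [he], h₀⟩
  · exact ⟨v, by simp [he], h₁⟩
  · exact absurd h ht'

theorem mem_of_arc_eq_vertexMap {e : G.edgeSet} {t : ℝ} (ht : t ∈ Set.Icc (0 : ℝ) 1) {w : V}
    (h : D.arc e t = D.vertexMap w) : w ∈ (e : Sym2 V) := by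
  obtain ⟨w', hw', h'⟩ :=
    D.exists_mem_arc_eq_vertexMap ht fun ht' ↦ D.arc_avoids_vertices e t ht' w h
  rwa [← D.vertexMap_injective (h'.symm.trans h)]

/-- The union of the arcs of the edges in a list. -/
def trace (l : List (Sym2 V)) : Set (ℝ × ℝ) :=
  {p | ∃ e : G.edgeSet, (e : Sym2 V) ∈ l ∧ p ∈ D.arc e '' Set.Icc 0 1}

theorem joinedIn_arc {u v : V} (e : G.edgeSet) (he : (e : Sym2 V) = s(u, v)) :
    JoinedIn (D.arc e '' Set.Icc 0 1) (D.vertexMap u) (D.vertexMap v) := by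
  obtain ⟨u', v', he', h₀, h₁⟩ := D.arc_endpoints e
  have h := JoinedIn.ofLine (D.arc_continuousOn e) h₀ h₁ subset_rfl
  rcases Sym2.eq_iff.1 (he.symm.trans he') with ⟨rfl, rfl⟩ | ⟨rfl, rfl⟩
  · exact h
  · exact h.symm

/-- The pairs of edges that cross in a drawing. -/
def crossingPairs : Set (Sym2 (Sym2 V)) :=
  (fun x ↦ x.1.map Subtype.val) '' D.crossings

theorem mem_crossingPairs_of_arcs_intersect {e f : G.edgeSet}
    (hef : ∀ w ∈ (e : Sym2 V), w ∉ (f : Sym2 V)) {p : ℝ × ℝ} (hpe : p ∈ D.arc e '' Set.Icc 0 1)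
    (hpf : p ∈ D.arc f '' Set.Icc 0 1) : s((e : Sym2 V), (f : Sym2 V)) ∈ D.crossingPairs := by
  obtain ⟨s, hs, hsp⟩ := hpe
  obtain ⟨t, ht, htp⟩ := hpf
  have hs' : s ∈ Set.Ioo (0 : ℝ) 1 := by
    by_contra hs'
    obtain ⟨w, hw, h⟩ := D.exists_mem_arc_eq_vertexMap hs hs'
    exact hef w hw (D.mem_of_arc_eq_vertexMap ht (by rw [htp, ← hsp, h]))
  have ht' : t ∈ Set.Ioo (0 : ℝ) 1 := by
    by_contra ht'
    obtain ⟨w, hw, h⟩ := D.exists_mem_arc_eq_vertexMap ht ht'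
    exact hef w (D.mem_of_arc_eq_vertexMap hs (by rw [hsp, ← htp, h])) hw
  have hne : e ≠ f := by
    rintro rfl
    exact hef _ (Sym2.out_fst_mem e.1) (Sym2.out_fst_mem e.1)
  exact ⟨(s(e, f), p), ⟨e, f, hne, rfl, ⟨s, hs', hsp⟩, ⟨t, ht', htp⟩⟩, rfl⟩

end Drawing

namespace List

variable {V W : Type*}

/-- The edges of the path visiting the vertices of a list in order. -/
def pathEdges : List V → List (Sym2 V)
  | u :: v :: l => s(u, v) :: pathEdges (v :: l)
  | _ => []

theorem pathEdges_map (f : V → W) : ∀ l : List V, (l.map f).pathEdges = l.pathEdges.map (Sym2.map f)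
  | [] => rfl
  | [_] => rfl
  | _ :: v :: l => congrArg _ (pathEdges_map f (v :: l))

theorem mem_of_mem_pathEdges {e : Sym2 V} {w : V} (hw : w ∈ e) :
    ∀ {l : List V}, e ∈ l.pathEdges → w ∈ l
  | [], h => by simp [pathEdges] at h
  | [_], h => by simp [pathEdges] at h
  | u :: v :: l, h => by
    rcases List.mem_cons.1 h with rfl | h
    · rcases Sym2.mem_iff.1 hw with rfl | rfl <;> simp
    · exact List.mem_cons_of_mem _ (mem_of_mem_pathEdges hw h)

end List

theorem Drawing.joinedIn_trace {V : Type*} {G : SimpleGraph V} (D : Drawing G) (v : V) :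
    ∀ (u : V) (l : List V), (u :: (l ++ [v])).IsChain G.Adj →
      JoinedIn (D.trace (u :: (l ++ [v])).pathEdges) (D.vertexMap u) (D.vertexMap v)
  | u, [], h => by
    have huv : G.Adj u v := by simpa using h
    refine (D.joinedIn_arc ⟨s(u, v), huv⟩ rfl).mono fun p hp ↦ ⟨_, ?_, hp⟩
    simp [List.pathEdges]
  | u, w :: l, h => by
    rw [List.cons_append, List.isChain_cons_cons] at h
    refine JoinedIn.trans (y := D.vertexMap w) ?_ ?_
    · refine (D.joinedIn_arc ⟨s(u, w), h.1⟩ rfl).mono fun p hp ↦ ⟨_, ?_, hp⟩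
      simp [List.pathEdges]
    · refine (D.joinedIn_trace v w l h.2).mono ?_
      rintro p ⟨e, he, hp⟩
      exact ⟨e, List.mem_cons_of_mem _ he, hp⟩

/-- The data of a subdivision of `K₃,₃` with vertices in `V`: the two triples of branch vertices
and the lists of subdividing vertices on the nine paths between them. -/
structure K33Subdivision (V : Type*) where
  left : Fin 3 → V
  right : Fin 3 → V
  inner : Fin 3 → Fin 3 → List V

namespace K33Subdivision

variable {V W : Type*} (K : K33Subdivision V)

/-- The vertices on the path from `left i` to `right j`. -/
def path (i j : Fin 3) : List V := K.left i :: (K.inner i j ++ [K.right j])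

/-- The image of a subdivision under a map of the vertices. -/
def map (f : V → W) : K33Subdivision W where
  left := f ∘ K.left
  right := f ∘ K.right
  inner i j := (K.inner i j).map f

theorem path_map (f : V → W) (i j : Fin 3) : (K.map f).path i j = (K.path i j).map f := by
  simp [path, map]

/-- The nine paths are paths in `G`, and those without a common end are disjoint. -/
def IsIn (G : SimpleGraph V) : Prop :=
  (∀ i j, (K.path i j).IsChain G.Adj) ∧
    ∀ i k j l, i ≠ k → j ≠ l → ∀ w ∈ K.path i j, w ∉ K.path k l

/-- The pairs of edges on paths without a common end. -/
def pairs : List (Sym2 (Sym2 V)) :=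
  [(0, 1), (0, 2), (1, 2)].flatMap fun (i, k) ↦
    [(0, 1), (0, 2), (1, 0), (1, 2), (2, 0), (2, 1)].flatMap fun (j, l) ↦
      (K.path i j).pathEdges.flatMap fun e ↦ (K.path k l).pathEdges.map fun f ↦ s(e, f)

theorem mem_pairs {i k j l : Fin 3} (hik : i ≠ k) (hjl : j ≠ l) {e f : Sym2 V}
    (he : e ∈ (K.path i j).pathEdges) (hf : f ∈ (K.path k l).pathEdges) : s(e, f) ∈ K.pairs := by
  wlog h : i < k generalizing i k j l e f
  · rw [Sym2.eq_swap]
    exact this hik.symm hjl.symm hf he (lt_of_le_of_ne (not_lt.1 h) hik.symm)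
  have hik' : ∀ i k : Fin 3, i < k → (i, k) ∈ [((0 : Fin 3), (1 : Fin 3)), (0, 2), (1, 2)] := by
    decide
  have hjl' : ∀ j l : Fin 3, j ≠ l →
      (j, l) ∈ [((0 : Fin 3), (1 : Fin 3)), (0, 2), (1, 0), (1, 2), (2, 0), (2, 1)] := by
    decide
  exact List.mem_flatMap.2 ⟨_, hik' i k h, List.mem_flatMap.2 ⟨_, hjl' j l hjl, List.mem_flatMap.2
    ⟨e, he, List.mem_map.2 ⟨f, hf, rfl⟩⟩⟩⟩

theorem pairs_map (f : V → W) : (K.map f).pairs = K.pairs.map (Sym2.map (Sym2.map f)) := by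
  simp [pairs, path_map, List.pathEdges_map, List.map_flatMap, List.flatMap_map, Function.comp_def]

variable {K}

theorem IsIn.map {G : SimpleGraph V} {H : SimpleGraph W} (hK : K.IsIn G) {f : V → W}
    (hf : Function.Injective f) (hadj : ∀ u v, G.Adj u v → H.Adj (f u) (f v)) :
    (K.map f).IsIn H := by
  refine ⟨fun i j ↦ ?_, fun i k j l hik hjl w hw hw' ↦ ?_⟩
  · rw [path_map, List.isChain_map]
    exact (hK.1 i j).imp hadj
  · rw [path_map, List.mem_map] at hw hw'
    obtain ⟨u, hu, rfl⟩ := hw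
    obtain ⟨v, hv, huv⟩ := hw'
    rw [hf huv] at hv
    exact hK.2 i k j l hik hjl u hu hv

theorem IsIn.exists_mem_crossingPairs {G : SimpleGraph V} (hK : K.IsIn G) (D : Drawing G) :
    ∃ x ∈ D.crossingPairs, x ∈ K.pairs := by
  obtain ⟨i, k, j, l, hik, hjl, p, ⟨e, he, hpe⟩, ⟨f, hf, hpf⟩⟩ :=
    exists_inter_nonempty_of_joinedIn (S := fun i j ↦ D.trace (K.path i j).pathEdges) fun i j ↦
      D.joinedIn_trace (K.right j) (K.left i) (K.inner i j) (hK.1 i j)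
  refine ⟨_, D.mem_crossingPairs_of_arcs_intersect (fun w hw hw' ↦ ?_) hpe hpf,
    K.mem_pairs hik hjl he hf⟩
  exact hK.2 i k j l hik hjl w (List.mem_of_mem_pathEdges hw he) (List.mem_of_mem_pathEdges hw' hf)

end K33Subdivision

instance : DecidableRel G6_75.Adj := fun a b ↦
  decidable_of_iff (s(a, b) ∈ [s(0, 1), s(1, 2), s(2, 3), s(3, 4), s(4, 5), s(1, 3), s(2, 4)]) <| by
    revert a b
    simp only [G6_75, fromEdgeSet_adj, Set.mem_insert_iff, Set.mem_singleton_iff]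
    decide

namespace G6_75

/-- The automorphism of `G6_75` given by a sign: `-1` acts as the reversal of the path. -/
def reflection : ℤˣ →* Equiv.Perm (Fin 6) where
  toFun ε := if ε = 1 then 1 else Fin.revPerm
  map_one' := rfl
  map_mul' := by decide

/-- The action of the reflection of `G6_75` and the permutations of the triangle on the vertices of
the product. -/
def act (τ : ℤˣ × Equiv.Perm (Fin 3)) : Equiv.Perm (Fin 6 × Fin 3) :=
  (reflection τ.1).prodCongr τ.2

theorem act_mul (σ τ : ℤˣ × Equiv.Perm (Fin 3)) : act (σ * τ) = act σ * act τ := by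
  ext x : 1
  simp only [act, Prod.fst_mul, Prod.snd_mul, map_mul]
  rfl

theorem act_one : act 1 = 1 := by
  ext x : 1
  simp [act]

theorem adj_act (τ : ℤˣ × Equiv.Perm (Fin 3)) (u v : Fin 6 × Fin 3)
    (h : (G6_75 □ cycleGraph 3).Adj u v) : (G6_75 □ cycleGraph 3).Adj (act τ u) (act τ v) := by
  have h₁ : ∀ ε : ℤˣ, ∀ a b : Fin 6, G6_75.Adj a b →
      G6_75.Adj (reflection ε a) (reflection ε b) := by decide
  have h₂ : ∀ a b : Fin 3, (cycleGraph 3).Adj a b ↔ a ≠ b := by decide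
  rw [boxProd_adj] at h ⊢
  rcases h with h | h
  · exact .inl ⟨h₁ _ _ _ h.1, congrArg τ.2 h.2⟩
  · exact .inr ⟨(h₂ _ _).2 (τ.2.injective.ne ((h₂ _ _).1 h.1)), congrArg (reflection τ.1) h.2⟩

/-- Two subdivisions of `K₃,₃` in `G6_75 □ cycleGraph 3`. -/
def baseSubdivision : Bool → K33Subdivision (Fin 6 × Fin 3)
  | false =>
    { left := ![(1, 2), (2, 0), (3, 0)]
      right := ![(1, 0), (3, 2), (4, 0)]
      inner := ![![[], [], [(1, 1), (2, 1), (4, 1)]], ![[], [(2, 2)], []], ![[], [], []]] }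
  | true =>
    { left := ![(2, 0), (3, 2), (4, 2)]
      right := ![(2, 2), (3, 1), (4, 0)]
      inner := ![![[], [(2, 1)], []], ![[], [], [(3, 0)]], ![[], [(4, 1)], []]] }

theorem baseSubdivision_isIn (t : Bool) : (baseSubdivision t).IsIn (G6_75 □ cycleGraph 3) := by
  have h₁ : ∀ t i j, ((baseSubdivision t).path i j).IsChain fun x y ↦
      G6_75.Adj x.1 y.1 ∧ x.2 = y.2 ∨ (cycleGraph 3).Adj x.2 y.2 ∧ x.1 = y.1 := by decide +kernel
  have h₂ : ∀ t i k j l, i ≠ k → j ≠ l → ∀ w ∈ (baseSubdivision t).path i j,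
      w ∉ (baseSubdivision t).path k l := by decide +kernel
  exact ⟨fun i j ↦ (h₁ t i j).imp fun _ _ ↦ boxProd_adj.2, h₂ t⟩

/-- A numerical code of an edge. -/
def edgeCode (e : Sym2 (Fin 6 × Fin 3)) : ℕ :=
  e.lift ⟨fun u v ↦ ((3 * u.1.val + u.2.val) ^ 2 + 1) + ((3 * v.1.val + v.2.val) ^ 2 + 1),
    fun _ _ ↦ Nat.add_comm _ _⟩

/-- A numerical code of a pair of edges. The modulus makes the code small while keeping enough pairs
of edges apart for `card_filter_testBit_le`. -/
def pairCode (x : Sym2 (Sym2 (Fin 6 × Fin 3))) : ℕ :=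
  x.lift ⟨fun e f ↦ edgeCode e * edgeCode f % 1517,
    fun _ _ ↦ congrArg (· % 1517) (Nat.mul_comm _ _)⟩

/-- The number whose binary digits indicate the codes of the pairs of edges in a list. -/
def codeMask : List (Sym2 (Sym2 (Fin 6 × Fin 3))) → ℕ
  | [] => 0
  | x :: l => 2 ^ pairCode x ||| codeMask l

theorem testBit_codeMask {x : Sym2 (Sym2 (Fin 6 × Fin 3))} :
    ∀ {l : List (Sym2 (Sym2 (Fin 6 × Fin 3)))}, x ∈ l → (codeMask l).testBit (pairCode x)
  | y :: l, h => by
    rw [codeMask, Nat.testBit_or]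
    rcases List.mem_cons.1 h with rfl | h
    · simp
    · simp [testBit_codeMask h]

theorem card_filter_testBit_le (t : Bool) : (baseSubdivision t).pairs.all fun y ↦
    Finset.card {k : (ℤˣ × Equiv.Perm (Fin 3)) × Bool |
      (codeMask (baseSubdivision k.2).pairs).testBit
        (pairCode (y.map (Sym2.map (act k.1)))) = true} ≤ 4 := by
  revert t
  decide +kernel

theorem card_filter_mem_pairs_le_of_mem {t : Bool} {y : Sym2 (Sym2 (Fin 6 × Fin 3))}
    (hy : y ∈ (baseSubdivision t).pairs) :
    Finset.card {k : (ℤˣ × Equiv.Perm (Fin 3)) × Bool |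
      y.map (Sym2.map (act k.1)) ∈ (baseSubdivision k.2).pairs} ≤ 4 :=
  (Finset.card_le_card (Finset.monotone_filter_right _ fun _ _ ↦ testBit_codeMask)).trans
    (of_decide_eq_true (List.all_eq_true.1 (card_filter_testBit_le t) y hy))

theorem card_filter_mem_pairs_le (x : Sym2 (Sym2 (Fin 6 × Fin 3))) :
    Finset.card {k : (ℤˣ × Equiv.Perm (Fin 3)) × Bool |
      x.map (Sym2.map (act k.1)) ∈ (baseSubdivision k.2).pairs} ≤ 4 := by
  by_cases! hx : ∃ k : (ℤˣ × Equiv.Perm (Fin 3)) × Bool,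
      x.map (Sym2.map (act k.1)) ∈ (baseSubdivision k.2).pairs
  · obtain ⟨⟨τ, t⟩, hx⟩ := hx
    refine le_trans (Finset.card_le_card_of_injOn (fun k ↦ (k.1 * τ⁻¹, k.2)) ?_ ?_)
      (card_filter_mem_pairs_le_of_mem hx)
    · intro k hk
      have h' : act (k.1 * τ⁻¹) ∘ act τ = act k.1 := by
        rw [← Equiv.Perm.coe_mul, ← act_mul, inv_mul_cancel_right]
      simp only [Finset.coe_filter, Finset.mem_univ, true_and, Set.mem_ofPred_eq] at hk ⊢
      rwa [Sym2.map_map, ← Sym2.map_comp, h']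
    · rintro ⟨σ, s⟩ - ⟨σ', s'⟩ - h
      simpa using h
  · simp [Finset.filter_false_of_mem fun k _ ↦ hx k]

theorem six_le_ncard_crossings (D : Drawing (G6_75 □ cycleGraph 3)) (hD : D.crossings.Finite) :
    6 ≤ D.crossings.ncard := by
  classical
  have hX : D.crossingPairs.Finite := hD.image _
  have key := Finset.card_mul_le_card_mul
    (fun (k : (ℤˣ × Equiv.Perm (Fin 3)) × Bool) (x : Sym2 (Sym2 (Fin 6 × Fin 3))) ↦
      x.map (Sym2.map (act k.1)) ∈ (baseSubdivision k.2).pairs)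
    (s := Finset.univ) (t := hX.toFinset) (m := 1) (n := 4) ?_ ?_
  · have hcard : hX.toFinset.card ≤ D.crossings.ncard := by
      rw [← Set.ncard_eq_toFinset_card _ hX]
      exact Set.ncard_image_le hD
    have h24 : Fintype.card ((ℤˣ × Equiv.Perm (Fin 3)) × Bool) = 24 := by decide +kernel
    rw [Finset.card_univ, h24] at key
    lia
  · rintro ⟨τ, t⟩ -
    obtain ⟨x, hx, hx'⟩ := ((baseSubdivision_isIn t).map (act τ⁻¹).injective
      (adj_act τ⁻¹)).exists_mem_crossingPairs D
    refine Finset.card_pos.2 ⟨x, ?_⟩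
    rw [K33Subdivision.pairs_map, List.mem_map] at hx'
    obtain ⟨y, hy, rfl⟩ := hx'
    have h' : act τ ∘ act τ⁻¹ = id := by
      rw [← Equiv.Perm.coe_mul, ← act_mul, mul_inv_cancel, act_one, Equiv.Perm.coe_one]
    simp only [Finset.bipartiteAbove, Finset.mem_filter, Set.Finite.mem_toFinset]
    rw [Sym2.map_map, ← Sym2.map_comp, h', Sym2.map_id, Sym2.map_id]
    exact ⟨hx, hy⟩
  · intro x _
    exact card_filter_mem_pairs_le x

end G6_75

/-- Twice the signed area of the triangle with vertices `a`, `b` and `c`. -/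
def orient {R : Type*} [CommRing R] (a b c : R × R) : R :=
  (b.1 - a.1) * (c.2 - a.2) - (b.2 - a.2) * (c.1 - a.1)

theorem orient_map {R S : Type*} [CommRing R] [CommRing S] (f : R →+* S) (a b c : R × R) :
    orient (Prod.map f f a) (Prod.map f f b) (Prod.map f f c) = f (orient a b c) := by
  simp [orient]

theorem orient_lineMap (a b c d : ℝ × ℝ) (t : ℝ) :
    orient a b (AffineMap.lineMap c d t) = (1 - t) * orient a b c + t * orient a b d := by
  simp [orient, AffineMap.lineMap_apply]
  ring

theorem orient_lineMap_self (a b : ℝ × ℝ) (t : ℝ) :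
    orient a b (AffineMap.lineMap a b t) = 0 := by
  simp [orient, AffineMap.lineMap_apply]
  ring

theorem mul_neg_or_of_convexComb_eq_zero {x y t : ℝ} (ht : t ∈ Set.Ioo (0 : ℝ) 1)
    (h : (1 - t) * x + t * y = 0) : x * y < 0 ∨ x = 0 ∧ y = 0 := by
  obtain ⟨h₀, h₁⟩ := ht
  have hx : x = -t * y / (1 - t) := by
    rw [eq_div_iff (by linarith)]
    linarith
  rcases eq_or_ne y 0 with rfl | hy
  · exact .inr ⟨by simpa using hx, rfl⟩
  · refine .inl ?_
    have : 0 < t * (y * y) / (1 - t) := by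
      have := mul_self_pos.2 hy
      have : 0 < 1 - t := by linarith
      positivity
    calc x * y = -(t * (y * y) / (1 - t)) := by rw [hx]; ring
      _ < 0 := by linarith

namespace Drawing

variable {V : Type*} {G : SimpleGraph V}

theorem mk_out (e : Sym2 V) : s(e.out.1, e.out.2) = e := Quot.out_eq e

theorem adj_out (e : G.edgeSet) : G.Adj (e : Sym2 V).out.1 (e : Sym2 V).out.2 := by
  rw [← mem_edgeSet, mk_out]
  exact e.2

/-- The drawing with straight edges given by the positions of the vertices. -/
noncomputable def straightLine (pos : V → ℝ × ℝ) (hpos : Function.Injective pos)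
    (hor : ∀ a b w, G.Adj a b → w ≠ a → w ≠ b → orient (pos a) (pos b) (pos w) ≠ 0) :
    Drawing G where
  vertexMap := pos
  vertexMap_injective := hpos
  arc e := AffineMap.lineMap (pos (e : Sym2 V).out.1) (pos (e : Sym2 V).out.2)
  arc_continuousOn e := AffineMap.lineMap_continuous.continuousOn
  arc_injOn e := by
    have h := adj_out e
    exact (AffineMap.lineMap_injective ℝ (hpos.ne h.ne)).injOn
  arc_endpoints e := ⟨_, _, (mk_out _).symm,
    AffineMap.lineMap_apply_zero _ _, AffineMap.lineMap_apply_one _ _⟩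
  arc_avoids_vertices e t ht w hw := by
    have h := adj_out e
    have hinj := AffineMap.lineMap_injective ℝ (hpos.ne h.ne)
    refine hor _ _ w h ?_ ?_ (by rw [← hw, orient_lineMap_self])
    · rintro rfl
      exact ht.1.ne' (hinj (hw.trans (AffineMap.lineMap_apply_zero _ _).symm))
    · rintro rfl
      exact ht.2.ne (hinj (hw.trans (AffineMap.lineMap_apply_one _ _).symm))

variable {pos : V → ℝ × ℝ} {hpos : Function.Injective pos}
  {hor : ∀ a b w, G.Adj a b → w ≠ a → w ≠ b → orient (pos a) (pos b) (pos w) ≠ 0}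

theorem exists_lineMap_eq_of_straightLine {e : G.edgeSet} {a b : V} (he : (e : Sym2 V) = s(a, b))
    {t : ℝ} (ht : t ∈ Set.Ioo (0 : ℝ) 1) : ∃ t' ∈ Set.Ioo (0 : ℝ) 1,
      AffineMap.lineMap (pos a) (pos b) t' = (straightLine pos hpos hor).arc e t := by
  have h : s((e : Sym2 V).out.1, (e : Sym2 V).out.2) = s(a, b) := (mk_out _).trans he
  rcases Sym2.eq_iff.1 h with ⟨ha, hb⟩ | ⟨hb, ha⟩
  · exact ⟨t, ht, by rw [← ha, ← hb]; rfl⟩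
  · exact ⟨1 - t, ⟨by linarith [ht.2], by linarith [ht.1]⟩, by
      rw [AffineMap.lineMap_apply_one_sub, ← ha, ← hb]; rfl⟩

theorem orient_of_mem_crossings_straightLine {e f : G.edgeSet} {p : ℝ × ℝ}
    (h : (s(e, f), p) ∈ (straightLine pos hpos hor).crossings) {a b c d : V}
    (he : (e : Sym2 V) = s(a, b)) (hf : (f : Sym2 V) = s(c, d)) :
    ∃ t ∈ Set.Ioo (0 : ℝ) 1, AffineMap.lineMap (pos c) (pos d) t = p ∧
      (1 - t) * orient (pos a) (pos b) (pos c) + t * orient (pos a) (pos b) (pos d) = 0 := by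
  have : (∃ s ∈ Set.Ioo (0 : ℝ) 1, (straightLine pos hpos hor).arc e s = p) ∧
      (∃ t ∈ Set.Ioo (0 : ℝ) 1, (straightLine pos hpos hor).arc f t = p) := by
    obtain ⟨e', f', -, hef, he', hf'⟩ := h
    rcases Sym2.eq_iff.1 hef with ⟨rfl, rfl⟩ | ⟨rfl, rfl⟩
    · exact ⟨he', hf'⟩
    · exact ⟨hf', he'⟩
  obtain ⟨⟨s, hs, hsp⟩, ⟨t, ht, htp⟩⟩ := this
  obtain ⟨s', hs', h₁⟩ := exists_lineMap_eq_of_straightLine (hpos := hpos) (hor := hor) he hs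
  obtain ⟨t', ht', h₂⟩ := exists_lineMap_eq_of_straightLine (hpos := hpos) (hor := hor) hf ht
  refine ⟨t', ht', h₂.trans htp, ?_⟩
  rw [← orient_lineMap, h₂, htp, ← hsp, ← h₁, orient_lineMap_self]

theorem injOn_fst_crossings_straightLine :
    Set.InjOn Prod.fst (straightLine pos hpos hor).crossings := by
  rintro ⟨x, p⟩ hp ⟨_, q⟩ hq (rfl : x = _)
  have hp' := hp
  obtain ⟨e, f, hef, rfl, -⟩ := hp'
  refine Prod.ext rfl ?_
  obtain ⟨⟨a, b⟩, he⟩ := e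
  obtain ⟨⟨c, d⟩, hf⟩ := f
  obtain ⟨s, -, hs, hs'⟩ := orient_of_mem_crossings_straightLine hp rfl rfl
  obtain ⟨t, -, ht, ht'⟩ := orient_of_mem_crossings_straightLine hq rfl rfl
  suffices s = t by rw [← hs, ← ht, this]
  have hne : orient (pos a) (pos b) (pos c) - orient (pos a) (pos b) (pos d) ≠ 0 := by
    intro h0
    have hc : orient (pos a) (pos b) (pos c) = 0 := by linear_combination hs' + s * h0
    have hd : orient (pos a) (pos b) (pos d) = 0 := by linear_combination hc - h0
    have hcab : c = a ∨ c = b := by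
      by_contra! h
      exact hor a b c he h.1 h.2 hc
    have hdab : d = a ∨ d = b := by
      by_contra! h
      exact hor a b d he h.1 h.2 hd
    have hcd : c ≠ d := G.ne_of_adj hf
    refine hef (Subtype.ext ?_)
    change s(a, b) = s(c, d)
    rcases hcab with rfl | rfl <;> rcases hdab with rfl | rfl
    · exact absurd rfl hcd
    · rfl
    · exact Sym2.eq_swap
    · exact absurd rfl hcd
  refine mul_right_cancel₀ hne ?_
  linear_combination ht' - hs'

theorem orient_mul_orient_of_mem_crossings_straightLine {e f : G.edgeSet} {p : ℝ × ℝ}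
    (h : (s(e, f), p) ∈ (straightLine pos hpos hor).crossings) {a b c d : V}
    (he : (e : Sym2 V) = s(a, b)) (hf : (f : Sym2 V) = s(c, d)) :
    orient (pos a) (pos b) (pos c) * orient (pos a) (pos b) (pos d) < 0 ∨
      orient (pos a) (pos b) (pos c) = 0 ∧ orient (pos a) (pos b) (pos d) = 0 := by
  obtain ⟨t, ht, -, h'⟩ := orient_of_mem_crossings_straightLine h he hf
  exact mul_neg_or_of_convexComb_eq_zero ht h'

end Drawing

namespace G6_75

/-- Positions of the vertices of the product, invariant under the affine map
`(x, y) ↦ (-y, x - y)` of order three. -/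
def position (v : Fin 6 × Fin 3) : ℤ × ℤ :=
  (fun p : ℤ × ℤ ↦ (-p.2, p.1 - p.2))^[v.2]
    (![(0, -3), (-7, -5), (9, -2), (11, -7), (15, -8), (16, -14)] v.1)

/-- The edges of the product, each with one of its orientations. -/
def orientedEdges : List ((Fin 6 × Fin 3) × (Fin 6 × Fin 3)) :=
  (List.finRange 3).flatMap (fun c ↦
    [(0, 1), (1, 2), (2, 3), (3, 4), (4, 5), (1, 3), (2, 4)].map fun (g, h) ↦ ((g, c), (h, c))) ++
  (List.finRange 6).flatMap fun g ↦
    [(0, 1), (0, 2), (1, 2)].map fun (c, d) ↦ ((g, c), (g, d))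

theorem exists_mem_orientedEdges {e : Sym2 (Fin 6 × Fin 3)}
    (he : e ∈ (G6_75 □ cycleGraph 3).edgeSet) : ∃ x ∈ orientedEdges, e = s(x.1, x.2) := by
  have h : ∀ u v : Fin 6 × Fin 3,
      G6_75.Adj u.1 v.1 ∧ u.2 = v.2 ∨ (cycleGraph 3).Adj u.2 v.2 ∧ u.1 = v.1 →
        (u, v) ∈ orientedEdges ∨ (v, u) ∈ orientedEdges := by decide +kernel
  obtain ⟨u, v⟩ := e
  rcases h u v (boxProd_adj.1 he) with h | h
  · exact ⟨_, h, rfl⟩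
  · exact ⟨_, h, Sym2.eq_swap⟩

theorem position_injective : Function.Injective position := by
  decide +kernel

theorem orient_position_ne_zero {e : (Fin 6 × Fin 3) × (Fin 6 × Fin 3)} (he : e ∈ orientedEdges)
    {w : Fin 6 × Fin 3} (h₁ : w ≠ e.1) (h₂ : w ≠ e.2) :
    orient (position e.1) (position e.2) (position w) ≠ 0 := by
  have h : orientedEdges.all fun e ↦ ∀ w, w ≠ e.1 → w ≠ e.2 →
      orient (position e.1) (position e.2) (position w) ≠ 0 := by decide +kernel
  exact of_decide_eq_true (List.all_eq_true.1 h e he) w h₁ h₂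

/-- The six pairs of edges that cross in the straight line drawing. -/
def straightCrossings : Finset (Sym2 (Sym2 (Fin 6 × Fin 3))) :=
  {s(s((2, 0), (2, 1)), s((1, 1), (3, 1))), s(s((2, 0), (2, 2)), s((1, 0), (3, 0))),
    s(s((2, 1), (2, 2)), s((1, 2), (3, 2))), s(s((3, 0), (3, 1)), s((2, 0), (4, 0))),
    s(s((3, 0), (3, 2)), s((2, 2), (4, 2))), s(s((3, 1), (3, 2)), s((2, 1), (4, 1)))}

theorem mem_straightCrossings {e f : (Fin 6 × Fin 3) × (Fin 6 × Fin 3)} (he : e ∈ orientedEdges)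
    (hf : f ∈ orientedEdges) (hef : e ≠ f)
    (h₁ : orient (position e.1) (position e.2) (position f.1) *
        orient (position e.1) (position e.2) (position f.2) < 0 ∨
      orient (position e.1) (position e.2) (position f.1) = 0 ∧
        orient (position e.1) (position e.2) (position f.2) = 0)
    (h₂ : orient (position f.1) (position f.2) (position e.1) *
        orient (position f.1) (position f.2) (position e.2) < 0 ∨
      orient (position f.1) (position f.2) (position e.1) = 0 ∧
        orient (position f.1) (position f.2) (position e.2) = 0) :
    s(s(e.1, e.2), s(f.1, f.2)) ∈ straightCrossings := by
  have h : orientedEdges.all fun e ↦ orientedEdges.all fun f ↦ decide (e ≠ f →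
      (orient (position e.1) (position e.2) (position f.1) *
          orient (position e.1) (position e.2) (position f.2) < 0 ∨
        orient (position e.1) (position e.2) (position f.1) = 0 ∧
          orient (position e.1) (position e.2) (position f.2) = 0) →
      (orient (position f.1) (position f.2) (position e.1) *
          orient (position f.1) (position f.2) (position e.2) < 0 ∨
        orient (position f.1) (position f.2) (position e.1) = 0 ∧
          orient (position f.1) (position f.2) (position e.2) = 0) →
      s(s(e.1, e.2), s(f.1, f.2)) ∈ straightCrossings) := by decide +kernel
  exact of_decide_eq_true (List.all_eq_true.1 (List.all_eq_true.1 h e he) f hf) hef h₁ h₂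

/-- The position of a vertex as a point of the real plane. -/
def realPosition (v : Fin 6 × Fin 3) : ℝ × ℝ :=
  Prod.map (Int.castRingHom ℝ) (Int.castRingHom ℝ) (position v)

theorem orient_realPosition (u v w : Fin 6 × Fin 3) :
    orient (realPosition u) (realPosition v) (realPosition w) =
      (orient (position u) (position v) (position w) : ℤ) :=
  orient_map (Int.castRingHom ℝ) _ _ _

theorem exists_drawing : ∃ D : Drawing (G6_75 □ cycleGraph 3),
    D.crossings.Finite ∧ D.crossings.ncard ≤ 6 := by
  have hpos : Function.Injective realPosition :=
    (Prod.map_injective.2 ⟨Int.cast_injective, Int.cast_injective⟩).comp position_injective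
  have hor : ∀ a b w, (G6_75 □ cycleGraph 3).Adj a b → w ≠ a → w ≠ b →
      orient (realPosition a) (realPosition b) (realPosition w) ≠ 0 := by
    intro a b w hab hwa hwb
    obtain ⟨x, hx, h⟩ := exists_mem_orientedEdges (e := s(a, b)) hab
    rw [orient_realPosition, Int.cast_ne_zero]
    rcases Sym2.eq_iff.1 h with ⟨rfl, rfl⟩ | ⟨rfl, rfl⟩
    · exact orient_position_ne_zero hx hwa hwb
    · have h' := orient_position_ne_zero hx hwb hwa
      contrapose! h'
      rw [← neg_eq_zero, ← h']
      simp only [orient]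
      ring
  let D := Drawing.straightLine realPosition hpos hor
  have hmaps : Set.MapsTo (fun x : Sym2 (G6_75 □ cycleGraph 3).edgeSet × (ℝ × ℝ) ↦
      x.1.map Subtype.val) D.crossings straightCrossings := by
    rintro ⟨x, p⟩ hx
    have hx' := hx
    obtain ⟨e, f, hef, rfl, -⟩ := hx'
    obtain ⟨⟨a, b⟩, he, heab⟩ := exists_mem_orientedEdges e.2
    obtain ⟨⟨c, d⟩, hf, hfcd⟩ := exists_mem_orientedEdges f.2
    have h₁ := Drawing.orient_mul_orient_of_mem_crossings_straightLine hx heab hfcd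
    have h₂ := Drawing.orient_mul_orient_of_mem_crossings_straightLine
      (by rwa [Sym2.eq_swap] at hx) hfcd heab
    simp only [orient_realPosition] at h₁ h₂
    change s((e : Sym2 (Fin 6 × Fin 3)), (f : Sym2 (Fin 6 × Fin 3))) ∈ straightCrossings
    rw [heab, hfcd]
    refine mem_straightCrossings he hf ?_ (mod_cast h₁) (mod_cast h₂)
    rintro h
    exact hef (Subtype.ext (by rw [heab, hfcd, h]))
  have hinj : Set.InjOn (fun x : Sym2 (G6_75 □ cycleGraph 3).edgeSet × (ℝ × ℝ) ↦
      x.1.map Subtype.val) D.crossings :=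
    (Sym2.map.injective Subtype.val_injective).comp_injOn
      Drawing.injOn_fst_crossings_straightLine
  refine ⟨D, Set.Finite.of_injOn hmaps hinj straightCrossings.finite_toSet, ?_⟩
  refine (Set.ncard_le_ncard_of_injOn _ hmaps hinj straightCrossings.finite_toSet).trans ?_
  rw [Set.ncard_coe_finset]
  exact Finset.card_le_six

end G6_75

/-- The crossing number of `G⁶₇₅ □ C₃` is `6`. -/
theorem crossingNumber_G6_75_boxProd_C3 :
    crossingNumber (G6_75 □ SimpleGraph.cycleGraph 3) = 6 := by
  obtain ⟨D, hD, h⟩ := G6_75.exists_drawing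
  refine le_antisymm (le_trans (Nat.sInf_le ⟨D, hD, rfl⟩) h) ?_
  refine le_csInf ⟨_, D, hD, rfl⟩ ?_
  rintro _ ⟨D', hD', rfl⟩
  exact G6_75.six_le_ncard_crossings D' hD'
end
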